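/- arXiv:1702.02704 — 3 statements merged into one kernel-verified Lean document; each statement's English description precedes it below -/
import Mathlib

section
/- Suppose 1 ≤ a_0,…,a_{d-1} < a_d. Then Δ(A) is Gorenstein of index r if and only if a_i divides a_d for all 0 ≤ i ≤ d−1 and r·a_d = a_0 + a_1 + ⋯ + a_{d-1} + 1. -/
open scoped BigOperators
open MeasureTheory

noncomputable section

/-- The real point corresponding to a lattice point. -/
def toReal {d : ℕ} (v : Fin d → ℤ) : Fin d → ℝ := fun i => (v i : ℝ)

/-- The finite abelian group `Λ_Δ ⊆ (ℝ/ℤ)^{d+1}` attached to a lattice simplex with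
vertices `v 0, …, v d`. -/
def LambdaSet {d : ℕ} (v : Fin (d + 1) → Fin d → ℤ) :
    Set (Fin (d + 1) → AddCircle (1 : ℝ)) :=
  {lam | ∃ mu : Fin (d + 1) → ℝ,
    (∀ i, ((mu i : ℝ) : AddCircle (1 : ℝ)) = lam i) ∧
    (∀ j, ∃ n : ℤ, ∑ i, mu i * (v i j : ℝ) = (n : ℝ)) ∧
    (∃ n : ℤ, ∑ i, mu i = (n : ℝ))}

/-- The simplex spanned by the given lattice points. -/
def simplexOf {d : ℕ} (v : Fin (d + 1) → Fin d → ℤ) : Set (Fin d → ℝ) :=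
  convexHull ℝ (Set.range fun i => toReal (v i))

/-- The dual (polar) body `{y : ⟨x,y⟩ ≤ 1 ∀ x ∈ P}`. -/
def polarDual {d : ℕ} (P : Set (Fin d → ℝ)) : Set (Fin d → ℝ) :=
  {y | ∀ x ∈ P, ∑ i, x i * y i ≤ 1}

/-- A point of `ℝ^d` is a lattice point if all its coordinates are integers. -/
def IsLatticePoint {d : ℕ} (x : Fin d → ℝ) : Prop := ∀ i, ∃ n : ℤ, x i = (n : ℝ)

/-- A polytope is reflexive if the origin is its unique interior lattice point and its
dual polytope is again a lattice polytope. -/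
def IsReflexive {d : ℕ} (P : Set (Fin d → ℝ)) : Prop :=
  (0 ∈ interior P) ∧
  (∀ x ∈ interior P, IsLatticePoint x → x = 0) ∧
  ∃ V : Finset (Fin d → ℤ), polarDual P = convexHull ℝ (toReal '' (V : Set (Fin d → ℤ)))

/-- A lattice polytope is Gorenstein of index `r` if some lattice translate of its
`r`-th dilate is reflexive. -/
def IsGorenstein {d : ℕ} (P : Set (Fin d → ℝ)) (r : ℕ) : Prop :=
  ∃ w : Fin d → ℤ, IsReflexive ((fun x => (r : ℝ) • x + toReal w) '' P)

/-- Unimodular equivalence of subsets of `ℝ^d`. -/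
def UnimodEquiv {d : ℕ} (P Q : Set (Fin d → ℝ)) : Prop :=
  ∃ (U : Matrix (Fin d) (Fin d) ℤ) (w : Fin d → ℤ), IsUnit U.det ∧
    Q = (fun x => fun j => (∑ i, x i * (U i j : ℝ)) + (w j : ℝ)) '' P

/-- `P` is a lattice pyramid: it is unimodularly equivalent to
`conv(V × {0}, e_j)` for a finite set `V` of lattice points lying in a coordinate
hyperplane. -/
def IsLatticePyramid {d : ℕ} (P : Set (Fin d → ℝ)) : Prop :=
  ∃ (j : Fin d) (V : Finset (Fin d → ℤ)),
    (∀ x ∈ V, x j = 0) ∧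
    UnimodEquiv P (convexHull ℝ
      ((toReal '' (V : Set (Fin d → ℤ))) ∪ {fun i => if i = j then (1 : ℝ) else 0}))

/-- The vertices of the simplex `Δ(A)` associated to `A = (a 1, …, a d)`:
`v 0 = 0`, `v i = e_i` for `1 ≤ i ≤ d-1`, and
`v d = ∑_{j=1}^{d-1} (a d - a j) e_j + (a d) e_d`. -/
def simplexVerts (d : ℕ) (a : ℕ → ℤ) : Fin (d + 1) → Fin d → ℤ := fun i j =>
  if (i : ℕ) = 0 then 0
  else if (i : ℕ) = d then (if (j : ℕ) = d - 1 then a d else a d - a ((j : ℕ) + 1))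
  else if (j : ℕ) + 1 = (i : ℕ) then 1 else 0

/-- The vertices of the simplex `Δ(A,B)`: `v 0 = 0`, `v i = e_i` for
`i ∉ {0, s, d}`, `v s = ∑_{j=1}^s (a j) e_j`, `v d = ∑_{j=1}^d (b j) e_j`. -/
def simplexVerts2 (d s : ℕ) (a b : ℕ → ℤ) : Fin (d + 1) → Fin d → ℤ := fun i j =>
  if (i : ℕ) = 0 then 0
  else if (i : ℕ) = s then (if (j : ℕ) + 1 ≤ s then a ((j : ℕ) + 1) else 0)
  else if (i : ℕ) = d then b ((j : ℕ) + 1)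
  else if (j : ℕ) + 1 = (i : ℕ) then 1 else 0


open scoped Matrix

lemma mem_polarDual {d : ℕ} {ι : Type*} {p : ι → Fin d → ℝ} {y : Fin d → ℝ} :
    y ∈ polarDual (convexHull ℝ (Set.range p)) ↔ ∀ i, p i ⬝ᵥ y ≤ 1 := by
  constructor
  · exact fun hy i => hy _ (subset_convexHull ℝ _ ⟨i, rfl⟩)
  · intro hy
    have hc : Convex ℝ {x : Fin d → ℝ | x ⬝ᵥ y ≤ 1} := by
      intro x hx z hz α β hα hβ hαβ
      have h1 := mul_le_mul_of_nonneg_left (Set.mem_ofPred.1 hx) hα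
      have h2 := mul_le_mul_of_nonneg_left (Set.mem_ofPred.1 hz) hβ
      simp only [Set.mem_ofPred_eq, add_dotProduct, smul_dotProduct, smul_eq_mul]
      linarith
    exact convexHull_min (Set.range_subset_iff.2 hy) hc

section DualSystem

variable {d : ℕ} {ι : Type*} [Fintype ι] [DecidableEq ι]

/-- The data of a simplex with vertices `p i` and facet inequalities `-t i ≤ ⟨x, L i⟩`. -/
structure IsDualSystem (p L : ι → Fin d → ℝ) (t : ι → ℝ) (r : ℝ) : Prop where
  pos : 0 < r
  sum_normal : ∑ i, L i = 0
  sum_offset : ∑ i, t i = r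
  pairing : ∀ i j, p i ⬝ᵥ L j = (if i = j then r else 0) - t j
  expand : ∀ x, r • x = ∑ i, (x ⬝ᵥ L i) • p i

namespace IsDualSystem

variable {p L : ι → Fin d → ℝ} {t : ι → ℝ} {r : ℝ}

lemma sum_dotProduct (h : IsDualSystem p L t r) (x : Fin d → ℝ) : ∑ i, x ⬝ᵥ L i = 0 := by
  rw [← dotProduct_sum, h.sum_normal, dotProduct_zero]

lemma eq_zero (h : IsDualSystem p L t r) {x : Fin d → ℝ} (hx : ∀ i, x ⬝ᵥ L i = 0) : x = 0 := by
  have := h.expand x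
  simpa [hx, h.pos.ne'] using this

lemma sum_smul (h : IsDualSystem p L t r) : ∑ i, t i • p i = 0 := by
  refine h.eq_zero fun j => ?_
  simp only [_root_.sum_dotProduct, smul_dotProduct, h.pairing, smul_eq_mul, mul_sub, mul_ite,
    mul_zero, Finset.sum_sub_distrib, Finset.sum_ite_eq', Finset.mem_univ, if_true,
    ← Finset.sum_mul, h.sum_offset]
  ring

lemma convexHull_eq (h : IsDualSystem p L t r) :
    convexHull ℝ (Set.range p) = {x | ∀ i, -t i ≤ x ⬝ᵥ L i} := by
  apply Set.Subset.antisymm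
  · refine convexHull_min ?_ ?_
    · rintro _ ⟨i, rfl⟩ j
      rw [h.pairing]
      split_ifs <;> linarith [h.pos]
    · intro x hx y hy α β hα hβ hαβ i
      have h1 := mul_le_mul_of_nonneg_left (hx i) hα
      have h2 := mul_le_mul_of_nonneg_left (hy i) hβ
      have h3 : α * t i + β * t i = t i := by rw [← add_mul, hαβ, one_mul]
      simp only [add_dotProduct, smul_dotProduct, smul_eq_mul]
      linarith
  · intro x hx
    have hx' : x = ∑ i, ((x ⬝ᵥ L i + t i) / r) • p i := by
      have h1 : r • x = r • ∑ i, ((x ⬝ᵥ L i + t i) / r) • p i := by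
        simp only [Finset.smul_sum, smul_smul, mul_div_cancel₀ _ h.pos.ne', add_smul,
          Finset.sum_add_distrib, h.sum_smul, add_zero, h.expand x]
      exact smul_right_injective _ h.pos.ne' h1
    rw [hx']
    refine (convex_convexHull ℝ _).sum_mem (fun i _ => ?_) ?_
      (fun i _ => subset_convexHull ℝ _ ⟨i, rfl⟩)
    · exact div_nonneg (by linarith [hx i]) h.pos.le
    · rw [← Finset.sum_div, Finset.sum_add_distrib, h.sum_dotProduct, h.sum_offset, zero_add,
        div_self h.pos.ne']

lemma interior_eq [Nontrivial ι] (h : IsDualSystem p L t r) :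
    interior (convexHull ℝ (Set.range p)) = {x | ∀ i, -t i < x ⬝ᵥ L i} := by
  apply Set.Subset.antisymm
  · intro x hx i
    obtain ⟨k, hk⟩ := exists_ne i
    have hc : Continuous fun ε : ℝ => x + ε • (p k - p i) := by fun_prop
    have hev : ∀ᶠ ε in nhdsWithin (0 : ℝ) (Set.Ioi 0),
        x + ε • (p k - p i) ∈ convexHull ℝ (Set.range p) := by
      apply Filter.Eventually.filter_mono nhdsWithin_le_nhds
      apply hc.continuousAt.eventually_mem
      simpa using mem_interior_iff_mem_nhds.1 hx
    obtain ⟨ε, hε, hε0⟩ := (hev.and self_mem_nhdsWithin).exists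
    rw [h.convexHull_eq] at hε
    have h1 := hε i
    simp only [add_dotProduct, smul_dotProduct, sub_dotProduct, h.pairing, if_neg hk, if_true,
      smul_eq_mul] at h1
    have h2 := mul_pos (Set.mem_Ioi.1 hε0) h.pos
    linarith
  · apply interior_maximal
    · intro x hx
      rw [h.convexHull_eq]
      exact fun i => (hx i).le
    · simp only [Set.ofPred_forall]
      refine isOpen_iInter_of_finite fun i => isOpen_lt continuous_const ?_
      unfold dotProduct
      fun_prop

lemma polarDual_eq (h : IsDualSystem p L t r) {u : ι → Fin d → ℝ} (ht : ∀ i, 0 < t i)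
    (hu : ∀ i, L i = -t i • u i) :
    polarDual (convexHull ℝ (Set.range p)) = convexHull ℝ (Set.range u) := by
  apply Set.Subset.antisymm
  · intro y hy
    rw [mem_polarDual] at hy
    have key : y = ∑ i, (t i * (1 - p i ⬝ᵥ y) / r) • u i := by
      apply dotProduct_eq
      intro x
      rw [dotProduct_comm y, dotProduct_comm _ x, dotProduct_sum]
      have h1 : r * (x ⬝ᵥ y) = ∑ i, (x ⬝ᵥ L i) * (p i ⬝ᵥ y) := by
        rw [← smul_eq_mul, ← smul_dotProduct, h.expand, _root_.sum_dotProduct]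
        simp
      have h2 : r * ∑ i, x ⬝ᵥ ((t i * (1 - p i ⬝ᵥ y) / r) • u i) =
          ∑ i, ((x ⬝ᵥ L i) * (p i ⬝ᵥ y) - x ⬝ᵥ L i) := by
        rw [Finset.mul_sum]
        refine Finset.sum_congr rfl fun i _ => ?_
        rw [hu i]
        simp only [dotProduct_smul, smul_eq_mul]
        field_simp [h.pos.ne']
        ring
      rw [Finset.sum_sub_distrib, h.sum_dotProduct, sub_zero, ← h1] at h2
      exact (mul_left_cancel₀ h.pos.ne' h2).symm
    rw [key]
    refine (convex_convexHull ℝ _).sum_mem (fun i _ => ?_) ?_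
      (fun i _ => subset_convexHull ℝ _ ⟨i, rfl⟩)
    · exact div_nonneg (mul_nonneg (ht i).le (by linarith [hy i])) h.pos.le
    · have h3 : ∑ i, t i * (p i ⬝ᵥ y) = 0 := by
        have := congrArg (· ⬝ᵥ y) h.sum_smul
        simpa [_root_.sum_dotProduct] using this
      rw [← Finset.sum_div]
      simp only [mul_sub, mul_one, Finset.sum_sub_distrib, h3, h.sum_offset, sub_zero]
      exact div_self h.pos.ne'
  · refine convexHull_min ?_ ?_
    · rintro _ ⟨i, rfl⟩
      rw [mem_polarDual]
      intro k
      have h1 := h.pairing k i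
      rw [hu i, dotProduct_smul, smul_eq_mul] at h1
      have h2 : 0 ≤ if k = i then r else 0 := by split_ifs <;> linarith [h.pos]
      have := ht i
      by_contra! h3
      nlinarith
    · intro x hx z hz α β hα hβ hαβ
      rw [mem_polarDual] at *
      intro i
      have h1 := mul_le_mul_of_nonneg_left (hx i) hα
      have h2 := mul_le_mul_of_nonneg_left (hz i) hβ
      simp only [dotProduct_add, dotProduct_smul, smul_eq_mul]
      linarith

lemma isReflexive [Nontrivial ι] (h : IsDualSystem p L t r) (ht : ∀ i, 0 < t i)
    {u : ι → Fin d → ℤ} (hu : ∀ i, L i = -t i • toReal (u i)) :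
    IsReflexive (convexHull ℝ (Set.range p)) := by
  refine ⟨?_, ?_, ?_⟩
  · rw [h.interior_eq]
    intro i
    simpa using ht i
  · intro x hx hxl
    rw [h.interior_eq] at hx
    choose z hz using hxl
    have hnonneg : ∀ i, 0 ≤ x ⬝ᵥ L i := by
      intro i
      have h1 : x ⬝ᵥ toReal (u i) = ((z ⬝ᵥ u i : ℤ) : ℝ) := by
        simp [dotProduct, toReal, hz]
      have h2 := hx i
      rw [hu i, dotProduct_smul, smul_eq_mul, h1] at h2 ⊢
      have h3 : ((z ⬝ᵥ u i : ℤ) : ℝ) < 1 := by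
        have := ht i
        by_contra! h4
        nlinarith
      have h4 : z ⬝ᵥ u i ≤ 0 := by
        have : z ⬝ᵥ u i < 1 := by exact_mod_cast h3
        omega
      have h5 : ((z ⬝ᵥ u i : ℤ) : ℝ) ≤ 0 := by exact_mod_cast h4
      nlinarith [ht i]
    exact h.eq_zero fun i =>
      (Finset.sum_eq_zero_iff_of_nonneg fun i _ => hnonneg i).1 (h.sum_dotProduct x) i
        (Finset.mem_univ i)
  · classical
    refine ⟨Finset.univ.image u, ?_⟩
    rw [h.polarDual_eq ht hu]
    congr 1
    simp [Set.range_comp', Set.image_univ]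

lemma mem_extremePoints (h : IsDualSystem p L t r) (ht : ∀ i, 0 < t i) {u : ι → Fin d → ℝ}
    (hu : ∀ i, L i = -t i • u i) (i : ι) :
    u i ∈ (polarDual (convexHull ℝ (Set.range p))).extremePoints ℝ := by
  have hmem : u i ∈ polarDual (convexHull ℝ (Set.range p)) := by
    rw [h.polarDual_eq ht hu]
    exact subset_convexHull ℝ _ ⟨i, rfl⟩
  rw [mem_extremePoints_iff_left]
  refine ⟨hmem, ?_⟩
  rintro y hy z hz ⟨α, β, hα, hβ, hαβ, hyz⟩
  rw [mem_polarDual] at hy hz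
  have hone : ∀ k, k ≠ i → p k ⬝ᵥ u i = 1 := by
    intro k hk
    have h1 := h.pairing k i
    rw [hu i, dotProduct_smul, smul_eq_mul, if_neg hk] at h1
    have := ht i
    apply mul_left_cancel₀ this.ne'
    linarith
  have hy1 : ∀ k, k ≠ i → p k ⬝ᵥ (y - u i) = 0 := by
    intro k hk
    have h1 := hone k hk
    rw [dotProduct_sub, h1]
    rw [← hyz, dotProduct_add, dotProduct_smul, dotProduct_smul, smul_eq_mul, smul_eq_mul] at h1
    have h2 := hy k
    have h3 := mul_le_mul_of_nonneg_left (hz k) hβ.le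
    have h4 : α * 1 ≤ α * (p k ⬝ᵥ y) := by linarith
    linarith [le_of_mul_le_mul_left h4 hα]
  have hyi : p i ⬝ᵥ (y - u i) = 0 := by
    have h1 := congrArg (· ⬝ᵥ (y - u i)) h.sum_smul
    simp only [_root_.sum_dotProduct, smul_dotProduct, smul_eq_mul, zero_dotProduct] at h1
    rw [Finset.sum_eq_single i (fun k _ hk => by rw [hy1 k hk, mul_zero]) (by simp)] at h1
    exact (mul_eq_zero.1 h1).resolve_left (ht i).ne'
  have hall : ∀ k, p k ⬝ᵥ (y - u i) = 0 := fun k => by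
    by_cases hk : k = i
    · rw [hk, hyi]
    · exact hy1 k hk
  have hzero : y - u i = 0 := by
    apply dotProduct_eq_zero
    intro x
    have h1 := congrArg (· ⬝ᵥ (y - u i)) (h.expand x)
    simp only [_root_.sum_dotProduct, smul_dotProduct, smul_eq_mul, hall, mul_zero,
      Finset.sum_const_zero] at h1
    rw [dotProduct_comm]
    exact (mul_eq_zero.1 h1).resolve_left h.pos.ne'
  exact sub_eq_zero.1 hzero

lemma exists_integral_normal [Nontrivial ι] (h : IsDualSystem p L t r)
    (hP : IsReflexive (convexHull ℝ (Set.range p))) (i : ι) :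
    0 < t i ∧ ∃ u : Fin d → ℤ, L i = -t i • toReal u := by
  obtain ⟨h0, -, V, hV⟩ := hP
  have ht : ∀ i, 0 < t i := by
    rw [h.interior_eq] at h0
    intro i
    simpa using h0 i
  have hL : ∀ i, L i = -t i • ((-(t i)⁻¹) • L i) := fun i => by
    rw [smul_smul, neg_mul_neg, mul_inv_cancel₀ (ht i).ne', one_smul]
  have hmem := h.mem_extremePoints ht hL i
  rw [hV] at hmem
  obtain ⟨u, -, hu⟩ := extremePoints_convexHull_subset hmem
  exact ⟨ht i, u, by rw [hu]; exact hL i⟩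

end IsDualSystem

end DualSystem

lemma image_simplexOf {d : ℕ} (v : Fin (d + 1) → Fin d → ℤ) (r : ℕ) (w : Fin d → ℤ) :
    (fun x => (r : ℝ) • x + toReal w) '' simplexOf v =
      convexHull ℝ (Set.range fun i => (r : ℝ) • toReal (v i) + toReal w) := by
  let f : (Fin d → ℝ) →ᵃ[ℝ] (Fin d → ℝ) :=
    (r : ℝ) • AffineMap.id ℝ (Fin d → ℝ) + AffineMap.const ℝ _ (toReal w)
  have := f.image_convexHull (Set.range fun i => toReal (v i))
  rw [← Set.range_comp] at this
  exact this

/-- The linear parts of the barycentric coordinates of `Δ(A)`, except the one at the origin. -/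
def edgeForm (n : ℕ) (a : ℕ → ℤ) : Fin (n + 1) → Fin (n + 1) → ℝ :=
  Fin.snoc (α := fun _ => Fin (n + 1) → ℝ)
    (fun m : Fin n => Pi.single m.castSucc 1 +
      Pi.single (Fin.last n) ((a (m + 1) : ℝ) / a (n + 1) - 1))
    (Pi.single (Fin.last n) (1 / (a (n + 1) : ℝ)))

/-- The linear parts of the barycentric coordinates of `Δ(A)`. -/
def facetForm (n : ℕ) (a : ℕ → ℤ) : Fin (n + 2) → Fin (n + 1) → ℝ :=
  Fin.cons (α := fun _ => Fin (n + 1) → ℝ) (-∑ i, edgeForm n a i) (edgeForm n a)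

section FacetForm

variable {n : ℕ} {a : ℕ → ℤ}

@[simp] lemma facetForm_zero : facetForm n a 0 = -∑ i, edgeForm n a i := rfl

@[simp] lemma facetForm_succ (i : Fin (n + 1)) : facetForm n a i.succ = edgeForm n a i := rfl

lemma edgeForm_castSucc (m : Fin n) : edgeForm n a m.castSucc = Pi.single m.castSucc 1 +
    Pi.single (Fin.last n) ((a (m + 1) : ℝ) / a (n + 1) - 1) := by
  simp [edgeForm]

lemma edgeForm_last : edgeForm n a (Fin.last n) =
    Pi.single (Fin.last n) (1 / (a (n + 1) : ℝ)) := by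
  simp [edgeForm]

lemma dotProduct_edgeForm_castSucc (x : Fin (n + 1) → ℝ) (m : Fin n) :
    x ⬝ᵥ edgeForm n a m.castSucc =
      x m.castSucc + x (Fin.last n) * ((a (m + 1) : ℝ) / a (n + 1) - 1) := by
  simp [edgeForm_castSucc, dotProduct_add]

lemma dotProduct_edgeForm_last (x : Fin (n + 1) → ℝ) :
    x ⬝ᵥ edgeForm n a (Fin.last n) = x (Fin.last n) / a (n + 1) := by
  simp [edgeForm_last, div_eq_mul_inv]

lemma simplexVerts_zero : simplexVerts (n + 1) a 0 = 0 := by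
  ext j; simp [simplexVerts]

lemma simplexVerts_castSucc_succ (m : Fin n) :
    simplexVerts (n + 1) a m.castSucc.succ = Pi.single m.castSucc 1 := by
  ext j
  have := m.2.ne
  simp [simplexVerts, this, Pi.single_apply, Fin.ext_iff]

lemma simplexVerts_last_last : simplexVerts (n + 1) a (Fin.last n).succ (Fin.last n) =
    a (n + 1) := by
  simp [simplexVerts]

lemma simplexVerts_last_castSucc (m : Fin n) :
    simplexVerts (n + 1) a (Fin.last n).succ m.castSucc = a (n + 1) - a (m + 1) := by
  have := m.2.ne
  simp [simplexVerts, this]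

lemma toReal_dotProduct_edgeForm (hq : 0 < a (n + 1)) (i j : Fin (n + 1)) :
    toReal (simplexVerts (n + 1) a i.succ) ⬝ᵥ edgeForm n a j = if i = j then 1 else 0 := by
  have hq' : (a (n + 1) : ℝ) ≠ 0 := by exact_mod_cast hq.ne'
  induction j using Fin.lastCases with
  | last =>
    rw [dotProduct_edgeForm_last]
    induction i using Fin.lastCases with
    | last => simp [-Fin.succ_last, toReal, simplexVerts_last_last, hq']
    | cast m => simp [toReal, simplexVerts_castSucc_succ, (Fin.castSucc_lt_last m).ne]
  | cast k =>
    rw [dotProduct_edgeForm_castSucc]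
    induction i using Fin.lastCases with
    | last =>
      simp only [toReal, simplexVerts_last_last, simplexVerts_last_castSucc,
        if_neg (Fin.castSucc_lt_last k).ne']
      push_cast
      field_simp
      ring
    | cast m =>
      simp [toReal, simplexVerts_castSucc_succ, Pi.single_apply,
        (Fin.castSucc_lt_last m).ne', eq_comm]

lemma sum_edgeForm_smul (hq : 0 < a (n + 1)) (x : Fin (n + 1) → ℝ) :
    ∑ i, (x ⬝ᵥ edgeForm n a i) • toReal (simplexVerts (n + 1) a i.succ) = x := by
  have hq' : (a (n + 1) : ℝ) ≠ 0 := by exact_mod_cast hq.ne'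
  ext j
  simp only [Finset.sum_apply, Pi.smul_apply, smul_eq_mul, Fin.sum_univ_castSucc,
    dotProduct_edgeForm_castSucc, dotProduct_edgeForm_last, toReal, simplexVerts_castSucc_succ]
  induction j using Fin.lastCases with
  | last => simp [-Fin.succ_last, simplexVerts_last_last, hq', (Fin.castSucc_lt_last _).ne']
  | cast m =>
    simp [-Fin.succ_last, simplexVerts_last_castSucc, Pi.single_apply]
    field_simp
    ring

/-- The offsets of the facet inequalities of `r Δ(A) + w`. -/
def facetOffset (n : ℕ) (a : ℕ → ℤ) (r : ℕ) (w : Fin (n + 1) → ℤ) (i : Fin (n + 2)) : ℝ :=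
  (if i = 0 then (r : ℝ) else 0) - toReal w ⬝ᵥ facetForm n a i

lemma sum_facetForm : ∑ i, facetForm n a i = 0 := by
  simp [Fin.sum_univ_succ]

lemma isDualSystem (hq : 0 < a (n + 1)) {r : ℕ} (hr : 1 ≤ r) (w : Fin (n + 1) → ℤ) :
    IsDualSystem (fun i => (r : ℝ) • toReal (simplexVerts (n + 1) a i) + toReal w)
      (facetForm n a) (facetOffset n a r w) r where
  pos := by exact_mod_cast hr
  sum_normal := sum_facetForm
  sum_offset := by
    simp only [facetOffset, Finset.sum_sub_distrib, ← dotProduct_sum, sum_facetForm]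
    simp
  pairing i j := by
    have key : toReal (simplexVerts (n + 1) a i) ⬝ᵥ facetForm n a j =
        (if i = j then 1 else 0) - if j = 0 then 1 else 0 := by
      have hz : toReal (simplexVerts (n + 1) a 0) = 0 := by
        ext k; simp [toReal, simplexVerts_zero]
      induction i using Fin.cases with
      | zero => simp [hz, eq_comm]
      | succ i =>
        induction j using Fin.cases with
        | zero => simp [dotProduct_sum, toReal_dotProduct_edgeForm hq]
        | succ j => simp [toReal_dotProduct_edgeForm hq]
    rw [add_dotProduct, smul_dotProduct, key, facetOffset, smul_eq_mul]
    split_ifs <;> ring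
  expand x := by
    have hz : toReal (simplexVerts (n + 1) a 0) = 0 := by
      ext k; simp [toReal, simplexVerts_zero]
    have h1 : ∑ i, (x ⬝ᵥ facetForm n a i) • toReal (simplexVerts (n + 1) a i) = x := by
      rw [Fin.sum_univ_succ, hz, smul_zero, zero_add]
      exact sum_edgeForm_smul hq x
    simp only [smul_add, Finset.sum_add_distrib, ← Finset.sum_smul, ← dotProduct_sum,
      sum_facetForm, dotProduct_zero, zero_smul, add_zero, smul_comm _ (r : ℝ), ← Finset.smul_sum,
      h1]

lemma facetForm_zero_castSucc (m : Fin n) : facetForm n a 0 m.castSucc = -1 := by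
  simp [Fin.sum_univ_castSucc, edgeForm_castSucc, edgeForm_last, Pi.single_apply,
    (Fin.castSucc_lt_last _).ne]

lemma facetForm_zero_last (hq : 0 < a (n + 1)) {k : ℤ}
    (hk : (∑ i ∈ Finset.range (n + 1), a i) + 1 = a (n + 1) * k) :
    facetForm n a 0 (Fin.last n) = (n - k : ℤ) + (a 0 : ℝ) / a (n + 1) := by
  have hq' : (a (n + 1) : ℝ) ≠ 0 := by exact_mod_cast hq.ne'
  have hk' : (∑ i : Fin n, (a (i + 1) : ℝ)) + a 0 + 1 = a (n + 1) * k := by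
    rw [Finset.sum_range_succ', Finset.sum_range] at hk
    exact_mod_cast hk
  simp only [facetForm_zero, Pi.neg_apply, Finset.sum_apply, Fin.sum_univ_castSucc,
    edgeForm_castSucc, edgeForm_last, Pi.add_apply, Pi.single_eq_same, Pi.single_apply,
    (Fin.castSucc_lt_last _).ne', if_false, zero_add, Finset.sum_sub_distrib, ← Finset.sum_div,
    Finset.sum_const, Finset.card_univ, Fintype.card_fin, nsmul_eq_mul, mul_one]
  push_cast
  field_simp
  linarith

end FacetForm

lemma dvd_of_unit_fraction {q b z N : ℤ} (hb : 1 ≤ b) (hbq : b < q) {t : ℝ} (ht : 0 < t)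
    (htz : t = z + (b : ℝ) / q) (hN : t * N = 1) : b ∣ q ∧ t = (b : ℝ) / q := by
  have hq : (0 : ℝ) < q := by exact_mod_cast (by omega : 0 < q)
  have h1 : t * q = ((z * q + b : ℤ) : ℝ) := by
    rw [htz]; push_cast; field_simp
  have hpos : 0 < z * q + b := by
    have : (0 : ℝ) < ((z * q + b : ℤ) : ℝ) := h1 ▸ mul_pos ht hq
    exact_mod_cast this
  have hmul : (z * q + b) * N = q := by
    have : ((z * q + b : ℤ) : ℝ) * N = q := by
      rw [← h1, mul_right_comm, hN, one_mul]
    exact_mod_cast this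
  have hle : z * q + b ≤ q := Int.le_of_dvd (by omega) ⟨N, hmul.symm⟩
  have hz : z = 0 := by
    have h2 : z < 1 := by by_contra! h; nlinarith
    have h3 : -1 < z := by by_contra! h; nlinarith
    omega
  subst hz
  exact ⟨⟨N, by linarith⟩, by simpa using htz⟩

section Gorenstein

variable {n : ℕ} {a : ℕ → ℤ} {r : ℕ}

lemma facetOffset_zero (hq : 0 < a (n + 1)) {k : ℤ}
    (hk : (∑ i ∈ Finset.range (n + 1), a i) + 1 = a (n + 1) * k) {w : Fin (n + 1) → ℤ}
    (hw : w (Fin.last n) = -1) :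
    facetOffset n a r w 0 =
      ((r + ∑ m : Fin n, w m.castSucc + n - k : ℤ) : ℝ) + (a 0 : ℝ) / a (n + 1) := by
  simp only [facetOffset, dotProduct, Fin.sum_univ_castSucc, facetForm_zero_castSucc,
    facetForm_zero_last hq hk, if_true, toReal, hw, mul_neg, mul_one, Finset.sum_neg_distrib]
  push_cast
  ring

lemma facetOffset_castSucc {w : Fin (n + 1) → ℤ} (hw : w (Fin.last n) = -1) (m : Fin n) :
    facetOffset n a r w m.castSucc.succ =
      ((-w m.castSucc - 1 : ℤ) : ℝ) + (a (m + 1) : ℝ) / a (n + 1) := by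
  simp only [facetOffset, facetForm_succ, dotProduct_edgeForm_castSucc, Fin.succ_ne_zero, if_false,
    toReal, hw]
  push_cast
  ring

lemma facetOffset_last {w : Fin (n + 1) → ℤ} :
    facetOffset n a r w (Fin.last n).succ = -(w (Fin.last n)) / a (n + 1) := by
  simp only [facetOffset, facetForm_succ, dotProduct_edgeForm_last, Fin.succ_ne_zero, if_false,
    toReal]
  ring

lemma dvd_of_isGorenstein (hr : 1 ≤ r) (ha : ∀ i, i < n + 1 → 1 ≤ a i ∧ a i < a (n + 1))
    (hdvd : a (n + 1) ∣ (∑ i ∈ Finset.range (n + 1), a i) + 1)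
    (hG : IsGorenstein (simplexOf (simplexVerts (n + 1) a)) r) :
    (∀ i, i < n + 1 → a i ∣ a (n + 1)) ∧
      (r : ℤ) * a (n + 1) = (∑ i ∈ Finset.range (n + 1), a i) + 1 := by
  have hq : 0 < a (n + 1) := by have := ha 0 (by omega); omega
  have hq' : (a (n + 1) : ℝ) ≠ 0 := by exact_mod_cast hq.ne'
  have hqpos : (0 : ℝ) < a (n + 1) := by exact_mod_cast hq
  obtain ⟨k, hk⟩ := hdvd
  obtain ⟨w, hw⟩ := hG
  rw [image_simplexOf] at hw
  have hS := isDualSystem hq hr w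
  have hfacet := hS.exists_integral_normal hw
  have hlast : w (Fin.last n) = -1 := by
    obtain ⟨ht, u, hu⟩ := hfacet (Fin.last n).succ
    rw [facetOffset_last] at ht hu
    have h1 := congrFun hu (Fin.last n)
    simp only [facetForm_succ, edgeForm_last, Pi.single_eq_same, Pi.smul_apply, toReal,
      smul_eq_mul] at h1
    field_simp at h1
    have h2 : w (Fin.last n) * u (Fin.last n) = 1 := by
      have : (1 : ℝ) = w (Fin.last n) * u (Fin.last n) := by linarith
      exact_mod_cast this.symm
    have h3 : w (Fin.last n) < 0 := by
      have : (0 : ℝ) < -(w (Fin.last n)) := by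
        by_contra! h
        exact absurd ht (not_lt.2 (div_nonpos_of_nonpos_of_nonneg h hqpos.le))
      have : (w (Fin.last n) : ℝ) < 0 := by linarith
      exact_mod_cast this
    rcases Int.eq_one_or_neg_one_of_mul_eq_one h2 with h | h <;> omega
  have hmid : ∀ m : Fin n, a (m + 1) ∣ a (n + 1) ∧
      facetOffset n a r w m.castSucc.succ = (a (m + 1) : ℝ) / a (n + 1) := by
    intro m
    obtain ⟨ht, u, hu⟩ := hfacet m.castSucc.succ
    have h1 := congrFun hu m.castSucc
    simp [edgeForm_castSucc, (Fin.castSucc_lt_last _).ne, toReal] at h1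
    have := ha (m + 1) (by omega)
    refine dvd_of_unit_fraction (N := -u m.castSucc) this.1 this.2 ht
      (facetOffset_castSucc hlast m) ?_
    push_cast
    linarith
  have hzero : a 0 ∣ a (n + 1) ∧ facetOffset n a r w 0 = (a 0 : ℝ) / a (n + 1) := by
    obtain ⟨ht, u, hu⟩ := hfacet 0
    have h0 := ha 0 (by omega)
    obtain ⟨N, hN⟩ : ∃ N : ℤ, facetOffset n a r w 0 * N = 1 := by
      rcases Nat.eq_zero_or_pos n with rfl | hn
      · have h1 := congrFun hu (Fin.last 0)
        simp only [facetForm_zero, Fin.sum_univ_succ, Finset.univ_eq_empty, Finset.sum_empty,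
          add_zero] at h1
        rw [show (0 : Fin 1) = Fin.last 0 from rfl, edgeForm_last] at h1
        simp only [Pi.neg_apply, Pi.single_eq_same, Pi.smul_apply, smul_eq_mul, toReal] at h1
        refine ⟨a (0 + 1) * u (Fin.last 0), ?_⟩
        push_cast
        field_simp at h1
        rw [← mul_assoc, mul_comm (facetOffset _ _ _ _ _)]
        exact (neg_injective h1).symm
      · have h1 := congrFun hu (Fin.castSucc ⟨0, hn⟩)
        rw [facetForm_zero_castSucc] at h1
        simp only [Pi.smul_apply, smul_eq_mul, toReal] at h1
        exact ⟨u (Fin.castSucc ⟨0, hn⟩), by linarith⟩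
    exact dvd_of_unit_fraction h0.1 h0.2 ht (facetOffset_zero hq hk hlast) hN
  refine ⟨?_, ?_⟩
  · rintro (_ | i) hi
    · exact hzero.1
    · exact (hmid ⟨i, by omega⟩).1
  · have hsum := hS.sum_offset
    rw [Fin.sum_univ_succ, Fin.sum_univ_castSucc, hzero.2, facetOffset_last, hlast] at hsum
    simp only [(hmid _).2, ← Finset.sum_div] at hsum
    push_cast at hsum
    field_simp at hsum
    rw [Finset.sum_range_succ', Finset.sum_range]
    have : (r : ℝ) * a (n + 1) = (∑ i : Fin n, (a (i + 1) : ℝ)) + a 0 + 1 := by linarith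
    exact_mod_cast this

lemma isGorenstein_of_dvd (hr : 1 ≤ r) (ha : ∀ i, i < n + 1 → 1 ≤ a i ∧ a i < a (n + 1))
    (hd : ∀ i, i < n + 1 → a i ∣ a (n + 1))
    (hk : (r : ℤ) * a (n + 1) = (∑ i ∈ Finset.range (n + 1), a i) + 1) :
    IsGorenstein (simplexOf (simplexVerts (n + 1) a)) r := by
  have hq : 0 < a (n + 1) := by have := ha 0 (by omega); omega
  have hqpos : (0 : ℝ) < a (n + 1) := by exact_mod_cast hq
  have hk' : (∑ i ∈ Finset.range (n + 1), a i) + 1 = a (n + 1) * r := by rw [← hk, mul_comm]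
  have hquot : ∀ i, i < n + 1 → ∃ c : ℤ, (0 : ℝ) < a i ∧ (a (n + 1) : ℝ) = a i * c := by
    intro i hi
    obtain ⟨c, hc⟩ := hd i hi
    exact ⟨c, by exact_mod_cast (ha i hi).1, by exact_mod_cast hc⟩
  have hw : (-1 : Fin (n + 1) → ℤ) (Fin.last n) = -1 := rfl
  refine ⟨-1, ?_⟩
  rw [image_simplexOf]
  have hS := isDualSystem hq hr (-1)
  have hfacet : ∀ i, 0 < facetOffset n a r (-1) i ∧
      ∃ u : Fin (n + 1) → ℤ, facetForm n a i = -facetOffset n a r (-1) i • toReal u := by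
    intro i
    induction i using Fin.cases with
    | zero =>
      obtain ⟨c, hc0, hc⟩ := hquot 0 (by omega)
      have ht : facetOffset n a r (-1) 0 = (a 0 : ℝ) / a (n + 1) := by
        rw [facetOffset_zero hq hk' hw]; simp
      rw [ht]
      refine ⟨div_pos hc0 hqpos,
        Fin.snoc (α := fun _ => ℤ) (fun _ => c) (-((n - r) * c + 1)), ?_⟩
      have hc' : (c : ℝ) ≠ 0 := by rintro h; rw [h, mul_zero] at hc; exact hqpos.ne' hc
      ext j
      induction j using Fin.lastCases with
      | last =>
        rw [facetForm_zero_last hq hk', hc]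
        simp only [Pi.smul_apply, smul_eq_mul, toReal, Fin.snoc_last]
        push_cast
        field_simp
      | cast m =>
        rw [facetForm_zero_castSucc, hc]
        simp only [Pi.smul_apply, smul_eq_mul, toReal, Fin.snoc_castSucc]
        field_simp
    | succ i =>
      induction i using Fin.lastCases with
      | last =>
        have ht : facetOffset n a r (-1) (Fin.last n).succ = 1 / a (n + 1) := by
          rw [facetOffset_last, hw]; simp
        rw [ht]
        refine ⟨by positivity, -Pi.single (Fin.last n) 1, ?_⟩
        ext j
        simp only [facetForm_succ, edgeForm_last, Pi.smul_apply, smul_eq_mul, toReal,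
          Pi.neg_apply, Pi.single_apply]
        split_ifs <;> simp
      | cast m =>
        obtain ⟨c, hc0, hc⟩ := hquot (m + 1) (by omega)
        have hc' : (c : ℝ) ≠ 0 := by rintro h; rw [h, mul_zero] at hc; exact hqpos.ne' hc
        have ht : facetOffset n a r (-1) m.castSucc.succ = (a (m + 1) : ℝ) / a (n + 1) := by
          rw [facetOffset_castSucc hw]; simp
        rw [ht]
        refine ⟨div_pos hc0 hqpos,
          -Pi.single m.castSucc c + Pi.single (Fin.last n) (c - 1), ?_⟩
        ext j
        simp only [facetForm_succ, edgeForm_castSucc, Pi.smul_apply, smul_eq_mul, toReal,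
          Pi.neg_apply, Pi.add_apply, Pi.single_apply, hc]
        split_ifs <;> push_cast <;> field_simp <;> ring
  choose ht u hu using hfacet
  exact hS.isReflexive ht hu

end Gorenstein

/-- suppose `1 ≤ a i < a d` for all `0 ≤ i ≤ d-1` (where `a 0` is the
integer with `a d ∣ a 0 + ⋯ + a (d-1) + 1`).  Then `Δ(A)` is Gorenstein of index `r`
iff every `a i` divides `a d` and `r · a d = a 0 + ⋯ + a (d-1) + 1`. -/
theorem statement8 {d : ℕ} (hd : 1 ≤ d) (r : ℕ) (hr : 1 ≤ r) (a : ℕ → ℤ)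
    (ha : ∀ i, i < d → 1 ≤ a i ∧ a i < a d)
    (hdvd : a d ∣ (∑ i ∈ Finset.range d, a i) + 1) :
    IsGorenstein (simplexOf (simplexVerts d a)) r ↔
      ((∀ i, i < d → a i ∣ a d) ∧
        (r : ℤ) * a d = (∑ i ∈ Finset.range d, a i) + 1) := by
  obtain ⟨n, rfl⟩ : ∃ n, d = n + 1 := ⟨d - 1, by omega⟩
  exact ⟨dvd_of_isGorenstein hr ha hdvd, fun h => isGorenstein_of_dvd hr ha h.1 h.2⟩
end
end

section
/- Let p be prime and Δ ⊂ ℝ^d a d-dimensional lattice simplex with normalized volume p that is not a lattice pyramid over any lower-dimensional simplex. Then Δ is Gorenstein of index r if and only if d = rp − 1 and Λ_Δ is the cyclic group generated by (1/p, 1/p, …, 1/p) ∈ (ℝ/ℤ)^{d+1}. -/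
open scoped BigOperators
open MeasureTheory

noncomputable section

/-- The corner simplex `{x ≥ 0, ∑ x ≤ t}` in `ℝⁿ`. -/
def cornerSimplex (n : ℕ) (t : ℝ) : Set (Fin n → ℝ) := {x | (∀ i, 0 ≤ x i) ∧ ∑ i, x i ≤ t}

theorem isClosed_cornerSimplex (n : ℕ) (t : ℝ) : IsClosed (cornerSimplex n t) := by
  simp only [cornerSimplex, Set.ofPred_and, Set.ofPred_forall]
  exact (isClosed_iInter fun i => isClosed_le continuous_const (continuous_apply i)).inter
    (isClosed_le (by fun_prop) continuous_const)

theorem volume_cornerSimplex (n : ℕ) (t : ℝ) (ht : 0 ≤ t) :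
    volume (cornerSimplex n t) = ENNReal.ofReal (t ^ n / n.factorial) := by
  induction n generalizing t with
  | zero =>
    have : cornerSimplex 0 t = Set.univ := by ext; simp [cornerSimplex, ht]
    simp [this, Measure.volume_pi_eq_dirac 0]
  | succ n ih =>
    have hmp := (volume_preserving_piFinSuccAbove (fun _ : Fin (n + 1) => ℝ) 0).symm
    rw [← hmp.measure_preimage (isClosed_cornerSimplex _ t).measurableSet.nullMeasurableSet,
      Measure.volume_eq_prod, Measure.prod_apply
        (hmp.measurable (isClosed_cornerSimplex _ t).measurableSet)]
    have hslice : ∀ a : ℝ, volume (Prod.mk a ⁻¹'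
        ((MeasurableEquiv.piFinSuccAbove (fun _ : Fin (n + 1) => ℝ) 0).symm ⁻¹'
          cornerSimplex (n + 1) t)) =
        (Set.Icc 0 t).indicator (fun a => ENNReal.ofReal ((t - a) ^ n / n.factorial)) a := by
      intro a
      have hmem : ∀ y : Fin n → ℝ, y ∈ Prod.mk a ⁻¹'
          ((MeasurableEquiv.piFinSuccAbove (fun _ : Fin (n + 1) => ℝ) 0).symm ⁻¹'
          cornerSimplex (n + 1) t) ↔ 0 ≤ a ∧ y ∈ cornerSimplex n (t - a) := by
        intro y
        simp only [cornerSimplex, Set.mem_preimage, Set.mem_ofPred_eq, Fin.forall_fin_succ,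
          Fin.sum_univ_succ, MeasurableEquiv.piFinSuccAbove_symm_apply, Fin.insertNthEquiv_apply,
          Fin.insertNth_zero, Fin.cons_zero, Fin.cons_succ, le_sub_iff_add_le', and_assoc]
        rfl
      by_cases ha : a ∈ Set.Icc 0 t
      · rw [Set.indicator_of_mem ha, ← ih (t - a) (by linarith [ha.2])]
        congr 1
        ext y
        rw [hmem]
        simp [ha.1]
      · rw [Set.indicator_of_notMem ha]
        convert measure_empty (μ := (volume : Measure (Fin n → ℝ)))
        ext y
        rw [hmem]
        simp only [Set.mem_empty_iff_false, iff_false]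
        rintro ⟨h0, hy⟩
        exact ha ⟨h0, by linarith [hy.2, Finset.sum_nonneg fun i (_ : i ∈ Finset.univ) => hy.1 i]⟩
    simp_rw [hslice]
    rw [lintegral_indicator measurableSet_Icc, ← ofReal_integral_eq_lintegral_ofReal]
    · rw [integral_Icc_eq_integral_Ioc, ← intervalIntegral.integral_of_le ht]
      congr 1
      rw [intervalIntegral.integral_div, intervalIntegral.integral_comp_sub_left (fun x => x ^ n)]
      simp [Nat.factorial_succ]
      field_simp
    · exact (Continuous.continuousOn (by fun_prop)).integrableOn_Icc
    · refine (ae_restrict_iff' measurableSet_Icc).2 (.of_forall fun a ha => ?_)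
      have := sub_nonneg.2 ha.2
      positivity

theorem mem_convexHull_range_iff {ι E : Type*} [Fintype ι] [AddCommGroup E] [Module ℝ E]
    (f : ι → E) (x : E) : x ∈ convexHull ℝ (Set.range f) ↔
      ∃ t : ι → ℝ, (∀ i, 0 ≤ t i) ∧ ∑ i, t i = 1 ∧ ∑ i, t i • f i = x := by
  classical
  rw [convexHull_range_eq_exists_affineCombination]
  constructor
  · rintro ⟨s, w, hw, hw1, rfl⟩
    refine ⟨fun i => if i ∈ s then w i else 0, fun i => ?_, by simpa using hw1, ?_⟩
    · dsimp only
      split_ifs with h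
      exacts [hw i h, le_rfl]
    · rw [Finset.affineCombination_eq_linear_combination _ _ _ hw1]
      simp [ite_smul]
  · rintro ⟨t, ht, ht1, rfl⟩
    exact ⟨Finset.univ, t, fun i _ => ht i, ht1,
      Finset.affineCombination_eq_linear_combination _ _ _ ht1⟩

theorem mem_simplexOf_iff {d : ℕ} (v : Fin (d + 1) → Fin d → ℤ) (x : Fin d → ℝ) :
    x ∈ simplexOf v ↔ ∃ t : Fin (d + 1) → ℝ, (∀ i, 0 ≤ t i) ∧ ∑ i, t i = 1 ∧
      ∀ j, ∑ i, t i * (v i j : ℝ) = x j := by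
  rw [simplexOf, mem_convexHull_range_iff]
  simp [funext_iff, toReal]

/-- The matrix of the lifted vertices `(1, v i)`. -/
def vertexMatrix {d : ℕ} (v : Fin (d + 1) → Fin d → ℤ) : Matrix (Fin (d + 1)) (Fin (d + 1)) ℤ :=
  Matrix.of fun i => Fin.cons 1 (v i)

theorem det_vertexMatrix {d : ℕ} (v : Fin (d + 1) → Fin d → ℤ) :
    (vertexMatrix v).det = (Matrix.of fun (i j : Fin d) => v i.succ j - v 0 j).det := by
  rw [Matrix.det_eq_of_forall_row_eq_smul_add_const (A := vertexMatrix v)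
    (B := Matrix.of (Fin.cons (Fin.cons 1 (v 0)) fun i => Fin.cons 0 fun j => v i.succ j - v 0 j))
    (Fin.cons 0 fun _ => 1) 0 rfl]
  · rw [Matrix.det_succ_column_zero, Fin.sum_univ_succ]
    simp
    congr 1
  · intro i j
    refine Fin.cases ?_ (fun i => ?_) i <;> refine Fin.cases ?_ (fun j => ?_) j <;>
      simp [vertexMatrix]

theorem volume_simplexOf {d : ℕ} (v : Fin (d + 1) → Fin d → ℤ) :
    volume (simplexOf v) =
      ENNReal.ofReal (|((vertexMatrix v).det : ℝ)| / d.factorial) := by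
  set E : Matrix (Fin d) (Fin d) ℝ :=
    (Matrix.of fun (i j : Fin d) => v i.succ j - v 0 j).map (Int.castRingHom ℝ) with hE
  have himg : simplexOf v =
      (fun y => toReal (v 0) + y) '' (Matrix.toLin' E.transpose '' cornerSimplex d 1) := by
    ext x
    rw [mem_simplexOf_iff, Set.image_image]
    have key : ∀ (t : Fin (d + 1) → ℝ), ∑ i, t i = 1 → ∀ j, ∑ i, t i * (v i j : ℝ) =
        (toReal (v 0) + Matrix.toLin' E.transpose fun i => t i.succ) j := by
      intro t ht j
      rw [Fin.sum_univ_succ] at ht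
      simp only [Fin.sum_univ_succ, Matrix.toLin'_apply, Pi.add_apply, Matrix.mulVec,
        dotProduct, toReal, hE, Matrix.transpose_apply, Matrix.map_apply, Matrix.of_apply,
        eq_intCast, Int.cast_sub, sub_mul, Finset.sum_sub_distrib, ← Finset.mul_sum]
      rw [eq_sub_of_add_eq ht]
      simp only [mul_comm]
      ring
    constructor
    · rintro ⟨t, ht, ht1, htx⟩
      refine ⟨fun i => t i.succ, ⟨fun i => ht _, ?_⟩, funext fun j => ?_⟩
      · rw [Fin.sum_univ_succ] at ht1
        linarith [ht 0]
      · rw [← htx, key t ht1]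
    · rintro ⟨y, ⟨hy, hy1⟩, rfl⟩
      have hs : ∑ i, (Fin.cons (1 - ∑ i, y i) y : Fin (d + 1) → ℝ) i = 1 := by
        simp [Fin.sum_univ_succ]
      refine ⟨Fin.cons (1 - ∑ i, y i) y, fun i => ?_, hs, fun j => ?_⟩
      · refine Fin.cases ?_ (fun i => ?_) i
        · simpa using hy1
        · simpa using hy i
      · rw [key _ hs]
        simp
  rw [himg, Set.image_add_left, measure_preimage_add, Measure.addHaar_image_linearMap,
    volume_cornerSimplex _ _ zero_le_one, ← ENNReal.ofReal_mul (abs_nonneg _), LinearMap.det_toLin',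
    Matrix.det_transpose, hE, ← RingHom.mapMatrix_apply, ← RingHom.map_det, det_vertexMatrix]
  simp [div_eq_mul_inv]

theorem isLatticePyramid_of_dual_vector {n : ℕ} (v : Fin (n + 2) → Fin (n + 1) → ℤ)
    (i : Fin (n + 2)) (u : Fin (n + 1) → ℤ)
    (hu : ∀ k ≠ i, ∑ j, u j * (v i j - v k j) = 1) : IsLatticePyramid (simplexOf v) := by
  obtain ⟨k₀, hk₀⟩ := exists_ne i
  set φ : (Fin (n + 1) → ℤ) →ₗ[ℤ] ℤ := Fintype.linearCombination ℤ u with hφ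
  have φ_apply : ∀ x, φ x = ∑ j, x j * u j := fun x => by
    simp [hφ, Fintype.linearCombination_apply]
  set t : Fin (n + 1) → ℤ := v i - v k₀ with ht
  have hφt : φ t = 1 := by
    rw [φ_apply, ← hu k₀ hk₀]
    exact Finset.sum_congr rfl fun j _ => mul_comm _ _
  have hsurj : Function.Surjective φ := fun z => ⟨z • t, by rw [map_smul, hφt]; simp⟩
  have hrank : Module.finrank ℤ (LinearMap.ker φ) = n := by
    have := Submodule.finrank_quotient_add_finrank (LinearMap.ker φ)
    rw [(φ.quotKerEquivOfSurjective hsurj).finrank_eq, Module.finrank_self,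
      Module.finrank_fin_fun] at this
    omega
  set B : Module.Basis (Fin (n + 1)) ℤ (Fin (n + 1) → ℤ) :=
    Module.Basis.mkFinCons t (Module.finBasisOfFinrankEq ℤ (LinearMap.ker φ) hrank)
      (fun c x hx h => by
        have := congrArg φ h
        rw [map_add, map_smul, hφt, LinearMap.mem_ker.1 hx] at this
        simpa using this)
      (fun z => ⟨-φ z, by rw [LinearMap.mem_ker, map_add, map_smul, hφt]; simp⟩) with hB
  have hrepr : ∀ x, B.repr x 0 = φ x := fun x => by
    conv_rhs => rw [← B.sum_repr x]
    have hB0 : B 0 = t := by rw [hB, Module.Basis.coe_mkFinCons]; rfl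
    have hBs : ∀ l : Fin n, φ (B l.succ) = 0 := fun l => by
      rw [hB, Module.Basis.coe_mkFinCons]
      exact (Module.finBasisOfFinrankEq ℤ (LinearMap.ker φ) hrank l).2
    simp only [map_add, map_sum, Fin.sum_univ_succ, map_smul, hB0, hBs, hφt, smul_eq_mul, mul_one,
      mul_zero, Finset.sum_const_zero, add_zero]
  set U : Matrix (Fin (n + 1)) (Fin (n + 1)) ℤ :=
    (B.toMatrix (Pi.basisFun ℤ (Fin (n + 1)))).transpose with hU
  have hU0 : ∀ l, U l 0 = u l := fun l => by
    simp [hU, Module.Basis.toMatrix_apply, hrepr, φ_apply, Pi.single_apply]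
  set w : Fin (n + 1) → ℤ := fun j => (if j = 0 then 1 else 0) - ∑ l, v i l * U l j with hw
  set q : Fin (n + 2) → Fin (n + 1) → ℤ := fun k j => ∑ l, v k l * U l j + w j with hq
  refine ⟨0, Finset.image q (Finset.univ.erase i), ?_, U, w, ?_, ?_⟩
  · intro x hx
    obtain ⟨k, hk, rfl⟩ := Finset.mem_image.1 hx
    have := hu k (Finset.ne_of_mem_erase hk)
    simp only [mul_sub, Finset.sum_sub_distrib] at this
    simp only [hq, hw, hU0, if_true, mul_comm (v _ _)]
    linarith
  · rw [hU, Matrix.det_transpose]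
    exact Matrix.isUnit_det_of_right_inverse
      (B.toMatrix_mul_toMatrix_flip (Pi.basisFun ℤ (Fin (n + 1))))
  · let g : (Fin (n + 1) → ℝ) →ᵃ[ℝ] (Fin (n + 1) → ℝ) :=
      (Matrix.vecMulLinear (U.map (Int.cast : ℤ → ℝ))).toAffineMap +
        AffineMap.const ℝ _ (toReal w)
    have hg : (fun x : Fin (n + 1) → ℝ => fun j => (∑ l, x l * (U l j : ℝ)) + (w j : ℝ)) = g := by
      ext x j
      simp [g, Matrix.vecMul, dotProduct, toReal]
    have hgq : ∀ k, g (toReal (v k)) = toReal (q k) := fun k => by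
      rw [← hg]
      ext j
      simp [toReal, hq]
    have hqi : toReal (q i) = fun j => if j = 0 then (1 : ℝ) else 0 := by
      ext j
      simp [toReal, hq, hw]
    rw [hg, simplexOf, AffineMap.image_convexHull, ← Set.range_comp]
    congr 1
    ext y
    simp only [Finset.coe_image, Finset.coe_erase, Finset.coe_univ, Set.mem_union, Set.mem_image,
      Set.mem_range, Function.comp, hgq, ← hqi, Set.mem_singleton_iff]
    constructor
    · rintro (⟨_, ⟨k, -, rfl⟩, rfl⟩ | rfl)
      exacts [⟨k, rfl⟩, ⟨i, rfl⟩]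
    · rintro ⟨k, rfl⟩
      by_cases hk : k = i
      · exact Or.inr (by rw [hk])
      · exact Or.inl ⟨_, ⟨k, by simpa using hk, rfl⟩, rfl⟩

theorem exists_sub_smul_mem_range_vecMul {ι : Type*} [Fintype ι] [DecidableEq ι]
    (A : Matrix ι ι ℤ) {p : ℕ} (hp : p.Prime) (hA : A.det.natAbs = p) (x : ι → ℤ)
    (hx : x ∉ LinearMap.range A.vecMulLinear) (y : ι → ℤ) :
    ∃ k : ℤ, y - k • x ∈ LinearMap.range A.vecMulLinear := by
  have hdet : A.det ≠ 0 := fun h => hp.ne_zero (by simpa [h] using hA.symm)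
  have hinj : Function.Injective A.vecMulLinear :=
    (injective_iff_map_eq_zero _).2 fun z hz => Matrix.eq_zero_of_vecMul_eq_zero hdet hz
  set N := LinearMap.range A.vecMulLinear with hN
  have hcard : Nat.card ((ι → ℤ) ⧸ N) = p := by
    have := Submodule.natAbs_det_equiv N (LinearEquiv.ofInjective _ hinj)
    rw [← this, ← hA, ← A.det_transpose, ← LinearMap.det_toLin']
    congr 2
    exact LinearMap.ext fun z => (A.mulVec_transpose z).symm
  have := Fact.mk hp
  have hx' : (Submodule.Quotient.mk x : (ι → ℤ) ⧸ N) ≠ 0 := by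
    rwa [Ne, Submodule.Quotient.mk_eq_zero]
  obtain ⟨k, hk⟩ := AddSubgroup.mem_zmultiples_iff.1
    ((zmultiples_eq_top_of_prime_card hcard hx').symm ▸ AddSubgroup.mem_top
      (Submodule.Quotient.mk y : (ι → ℤ) ⧸ N))
  refine ⟨k, (Submodule.Quotient.mk_eq_zero N).1 ?_⟩
  rw [Submodule.Quotient.mk_sub, ← hk]
  exact sub_self _

/-- `x ↦ α i + ⟨u i, x⟩` are the barycentric coordinates of the simplex with vertices `v`. -/
structure IsBarycentricDual {d : ℕ} (v : Fin (d + 1) → Fin d → ℤ) (α : Fin (d + 1) → ℝ)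
    (u : Fin (d + 1) → Fin d → ℝ) : Prop where
  apply_vertex : ∀ k i, α i + ∑ j, (v k j : ℝ) * u i j = if k = i then 1 else 0
  sum_const : ∑ i, α i = 1
  sum_const_mul : ∀ j, ∑ i, α i * v i j = 0
  sum_linear : ∀ j, ∑ i, u i j = 0
  sum_linear_mul : ∀ j l, ∑ i, u i j * v i l = if j = l then 1 else 0

theorem exists_isBarycentricDual {d p : ℕ} (hp : p ≠ 0) (v : Fin (d + 1) → Fin d → ℤ)
    (hdet : (vertexMatrix v).det.natAbs = p) :
    ∃ (α : Fin (d + 1) → ℝ) (u : Fin (d + 1) → Fin d → ℝ), IsBarycentricDual v α u ∧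
      (∀ i, ∃ n : ℤ, p * α i = n) ∧ ∀ i j, ∃ n : ℤ, p * u i j = n := by
  set M : Matrix (Fin (d + 1)) (Fin (d + 1)) ℝ := (vertexMatrix v).map (Int.castRingHom ℝ) with hM
  have hMdet : M.det = ((vertexMatrix v).det : ℝ) := by
    rw [hM, ← RingHom.mapMatrix_apply, ← RingHom.map_det]
    rfl
  have hunit : IsUnit M.det := by
    rw [hMdet, isUnit_iff_ne_zero, Int.cast_ne_zero]
    rintro h
    simp [h] at hdet
    exact hp hdet.symm
  have hM0 : ∀ i, M i 0 = 1 := fun i => by simp [hM, vertexMatrix]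
  have hMs : ∀ i j, M i (Fin.succ j) = v i j := fun i j => by simp [hM, vertexMatrix]
  have hint : ∀ i j, ∃ n : ℤ, p * M⁻¹ i j = n := by
    intro i j
    have h1 : (M.det) • M⁻¹ = (vertexMatrix v).adjugate.map (Int.castRingHom ℝ) := by
      rw [Matrix.inv_def, smul_smul, Ring.mul_inverse_cancel _ hunit, one_smul, hM,
        ← RingHom.mapMatrix_apply, ← RingHom.mapMatrix_apply, RingHom.map_adjugate]
    have h2 : M.det * M⁻¹ i j = ((vertexMatrix v).adjugate i j : ℝ) := congrFun₂ h1 i j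
    rw [hMdet] at h2
    rcases Int.natAbs_eq (vertexMatrix v).det with h | h <;> rw [hdet] at h <;> rw [h] at h2
    · exact ⟨_, by simpa using h2⟩
    · exact ⟨-(vertexMatrix v).adjugate i j, by push_cast at h2 ⊢; linarith⟩
  have hright : ∀ k i, ∑ l, M k l * M⁻¹ l i = if k = i then 1 else 0 := fun k i => by
    rw [← Matrix.mul_apply, Matrix.mul_nonsing_inv _ hunit, Matrix.one_apply]
  have hleft : ∀ k i, ∑ l, M⁻¹ k l * M l i = if k = i then 1 else 0 := fun k i => by
    rw [← Matrix.mul_apply, Matrix.nonsing_inv_mul _ hunit, Matrix.one_apply]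
  refine ⟨fun i => M⁻¹ 0 i, fun i j => M⁻¹ j.succ i, ⟨fun k i => ?_, ?_, fun j => ?_, fun j => ?_,
    fun j l => ?_⟩, fun i => hint _ _, fun i j => hint _ _⟩
  · simpa [Fin.sum_univ_succ, hM0, hMs] using hright k i
  · simpa [hM0] using hleft 0 0
  · simpa [hMs, (Fin.succ_ne_zero _).symm] using hleft 0 j.succ
  · simpa [hM0] using hleft j.succ 0
  · simpa [hMs] using hleft j.succ l.succ

namespace IsBarycentricDual

variable {d : ℕ} {v : Fin (d + 1) → Fin d → ℤ} {α : Fin (d + 1) → ℝ} {u : Fin (d + 1) → Fin d → ℝ}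

/-- `r` times the barycentric coordinates on the simplex with vertices `r • v i + w`. -/
def height (α : Fin (d + 1) → ℝ) (u : Fin (d + 1) → Fin d → ℝ) (r : ℕ) (w : Fin d → ℤ)
    (i : Fin (d + 1)) (x : Fin d → ℝ) : ℝ :=
  r * α i + ∑ j, (x j - w j) * u i j

/-- The translated dilate `r Δ + w`. -/
def dilate (v : Fin (d + 1) → Fin d → ℤ) (r : ℕ) (w : Fin d → ℤ) : Set (Fin d → ℝ) :=
  (fun x => (r : ℝ) • x + toReal w) '' simplexOf v

theorem sum_height (h : IsBarycentricDual v α u) (r : ℕ) (w : Fin d → ℤ) (x : Fin d → ℝ) :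
    ∑ i, height α u r w i x = r := by
  simp only [height, Finset.sum_add_distrib, ← Finset.mul_sum, h.sum_const]
  rw [Finset.sum_comm]
  simp [← Finset.mul_sum, h.sum_linear]

theorem sum_height_mul (h : IsBarycentricDual v α u) (r : ℕ) (w : Fin d → ℤ) (x : Fin d → ℝ)
    (l : Fin d) : ∑ i, height α u r w i x * v i l = x l - w l := by
  simp only [height, add_mul, Finset.sum_add_distrib, mul_assoc, ← Finset.mul_sum, h.sum_const_mul,
    Finset.sum_mul]
  rw [Finset.sum_comm]
  simp [← Finset.mul_sum, h.sum_linear_mul]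

theorem combination_injective (h : IsBarycentricDual v α u) {s t : Fin (d + 1) → ℝ}
    (hsum : ∑ i, s i = ∑ i, t i) (hv : ∀ j, ∑ i, s i * v i j = ∑ i, t i * v i j) : s = t := by
  have key : ∀ s : Fin (d + 1) → ℝ, ∀ i,
      s i = (∑ k, s k) * α i + ∑ j, (∑ k, s k * v k j) * u i j := by
    intro s i
    have : ∑ k, s k * (α i + ∑ j, (v k j : ℝ) * u i j) = s i := by simp [h.apply_vertex]
    rw [← this]
    simp only [mul_add, Finset.sum_add_distrib, ← Finset.sum_mul, Finset.mul_sum]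
    rw [Finset.sum_comm]
    simp only [← mul_assoc, ← Finset.sum_mul]
  ext i
  rw [key s, key t, hsum]
  simp only [hv]

theorem height_combination (h : IsBarycentricDual v α u) (r : ℕ) (w : Fin d → ℤ) (x : Fin d → ℝ)
    (s : Fin (d + 1) → ℝ) (hs : ∑ i, s i = r) (hx : ∀ j, ∑ i, s i * v i j = x j - w j)
    (i : Fin (d + 1)) : height α u r w i x = s i :=
  congrFun (h.combination_injective (s := fun i => height α u r w i x)
    (by rw [h.sum_height, hs]) fun j => by rw [h.sum_height_mul, hx]) i

theorem mem_dilate_iff (h : IsBarycentricDual v α u) {r : ℕ} (hr : 1 ≤ r) (w : Fin d → ℤ)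
    (x : Fin d → ℝ) : x ∈ dilate v r w ↔ ∀ i, 0 ≤ height α u r w i x := by
  have hr0 : (0 : ℝ) < r := by exact_mod_cast hr
  constructor
  · rintro ⟨q, hq, rfl⟩ i
    obtain ⟨t, ht, ht1, htq⟩ := (mem_simplexOf_iff v q).1 hq
    rw [h.height_combination r w _ (fun i => r * t i) (by rw [← Finset.mul_sum, ht1, mul_one])
      (fun j => by simp [mul_assoc, ← Finset.mul_sum, htq, toReal])]
    exact mul_nonneg hr0.le (ht i)
  · intro hx
    refine ⟨fun j => (x j - w j) / r, (mem_simplexOf_iff v _).2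
      ⟨fun i => height α u r w i x / r, fun i => div_nonneg (hx i) hr0.le, ?_, fun j => ?_⟩, ?_⟩
    · rw [← Finset.sum_div, h.sum_height, div_self hr0.ne']
    · simp only [div_mul_eq_mul_div, ← Finset.sum_div, h.sum_height_mul]
    · ext j
      simp [toReal, mul_div_cancel₀ _ hr0.ne']

theorem continuous_height (r : ℕ) (w : Fin d → ℤ) (i : Fin (d + 1)) :
    Continuous (height α u r w i) := by
  unfold height
  fun_prop

theorem mem_interior_dilate_iff (h : IsBarycentricDual v α u) (hd : d ≠ 0) {r : ℕ} (hr : 1 ≤ r)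
    (w : Fin d → ℤ) (x : Fin d → ℝ) :
    x ∈ interior (dilate v r w) ↔ ∀ i, 0 < height α u r w i x := by
  constructor
  · intro hx i
    have : Nontrivial (Fin (d + 1)) := Fin.nontrivial_iff_two_le.2 (by omega)
    obtain ⟨k, hk⟩ := exists_ne i
    let e : Fin d → ℝ := fun j => v k j - v i j
    have hcont : Filter.Tendsto (fun ε : ℝ => x + ε • e) (nhdsWithin 0 (Set.Ioi 0)) (nhds x) := by
      have : Continuous fun ε : ℝ => x + ε • e := by fun_prop
      simpa using (this.tendsto 0).mono_left nhdsWithin_le_nhds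
    obtain ⟨ε, hε, hε0⟩ := ((hcont.eventually (isOpen_interior.mem_nhds hx)).and
      self_mem_nhdsWithin).exists
    have hge := (h.mem_dilate_iff hr w _).1 (interior_subset hε) i
    have heq : height α u r w i (x + ε • e) = height α u r w i x - ε := by
      have h1 := h.apply_vertex k i
      have h2 := h.apply_vertex i i
      rw [if_neg hk] at h1
      rw [if_pos rfl] at h2
      have h3 : ∑ j, e j * u i j = -1 := by
        simp only [e, sub_mul, Finset.sum_sub_distrib]
        linarith
      simp only [height, Pi.add_apply, Pi.smul_apply, smul_eq_mul, add_sub_right_comm, add_mul,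
        Finset.sum_add_distrib, mul_assoc, ← Finset.mul_sum, h3]
      ring
    have : (0 : ℝ) < ε := hε0
    linarith
  · intro hx
    refine mem_interior.2 ⟨{y | ∀ i, 0 < height α u r w i y},
      fun y hy => (h.mem_dilate_iff hr w y).2 fun i => (hy i).le, ?_, hx⟩
    simp only [Set.ofPred_forall]
    exact isOpen_iInter_of_finite fun i => isOpen_lt continuous_const (continuous_height r w i)

/-- One minus the pairing of `y` with the `k`-th vertex of `r Δ + w`. -/
def slack (v : Fin (d + 1) → Fin d → ℤ) (r : ℕ) (w : Fin d → ℤ) (y : Fin d → ℝ)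
    (k : Fin (d + 1)) : ℝ :=
  1 - ∑ j, ((r : ℝ) * v k j + w j) * y j

theorem mem_polarDual_dilate_iff (r : ℕ) (w : Fin d → ℤ) (y : Fin d → ℝ) :
    y ∈ polarDual (dilate v r w) ↔ ∀ k, 0 ≤ slack v r w y k := by
  constructor
  · intro hy k
    have := hy (fun j => (r : ℝ) * v k j + w j)
      ⟨toReal (v k), subset_convexHull ℝ _ ⟨k, rfl⟩, by ext j; simp [toReal]⟩
    exact sub_nonneg.2 this
  · rintro hy _ ⟨q, hq, rfl⟩
    obtain ⟨t, ht, ht1, htq⟩ := (mem_simplexOf_iff v q).1 hq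
    have h1 : ∑ k, t k * slack v r w y k =
        1 - ∑ j, ((fun x => (r : ℝ) • x + toReal w) q) j * y j := by
      simp only [slack, mul_sub, mul_one, Finset.sum_sub_distrib, ht1, Finset.mul_sum]
      rw [Finset.sum_comm]
      congr 1
      refine Finset.sum_congr rfl fun j _ => ?_
      simp only [← mul_assoc, ← Finset.sum_mul, mul_add, Finset.sum_add_distrib, ht1,
        mul_comm (t _) (r : ℝ)]
      simp [toReal, mul_assoc, ← Finset.mul_sum, htq]
    have h2 : 0 ≤ ∑ k, t k * slack v r w y k :=
      Finset.sum_nonneg fun k _ => mul_nonneg (ht k) (hy k)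
    linarith

theorem sum_slack_mul_linear (h : IsBarycentricDual v α u) (r : ℕ) (w : Fin d → ℤ)
    (y : Fin d → ℝ) (j : Fin d) : ∑ k, slack v r w y k * u k j = -(r * y j) := by
  simp only [slack, sub_mul, one_mul, Finset.sum_sub_distrib, h.sum_linear, Finset.sum_mul,
    zero_sub, neg_inj]
  rw [Finset.sum_comm]
  have : ∀ l, ∑ k, ((r : ℝ) * v k l + w l) * y l * u k j = if j = l then r * y l else 0 := by
    intro l
    have : ∀ k, ((r : ℝ) * v k l + w l) * y l * u k j =
      r * y l * (u k j * v k l) + w l * y l * u k j := fun k => by ring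
    simp [this, Finset.sum_add_distrib, ← Finset.mul_sum, h.sum_linear_mul, h.sum_linear]
  simp [this]

theorem sum_slack_mul_height_zero (h : IsBarycentricDual v α u) (r : ℕ) (w : Fin d → ℤ)
    (y : Fin d → ℝ) : ∑ k, slack v r w y k * height α u r w k 0 = r := by
  simp only [slack, sub_mul, one_mul, Finset.sum_sub_distrib, h.sum_height, Finset.sum_mul]
  rw [Finset.sum_comm]
  have : ∀ l, ∑ k, ((r : ℝ) * v k l + w l) * y l * height α u r w k 0 = 0 := by
    intro l
    have : ∀ k, ((r : ℝ) * v k l + w l) * y l * height α u r w k 0 =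
      r * y l * (height α u r w k 0 * v k l) + w l * y l * height α u r w k 0 := fun k => by ring
    simp [this, Finset.sum_add_distrib, ← Finset.mul_sum, h.sum_height_mul, h.sum_height]
    ring
  simp [this]

/-- The vertices of the polar dual of `r Δ + w`. -/
def dualVertex (α : Fin (d + 1) → ℝ) (u : Fin (d + 1) → Fin d → ℝ) (r : ℕ) (w : Fin d → ℤ)
    (i : Fin (d + 1)) : Fin d → ℝ :=
  fun j => -u i j / height α u r w i 0

theorem slack_dualVertex (h : IsBarycentricDual v α u) (r : ℕ) (w : Fin d → ℤ) (i k : Fin (d + 1))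
    (hi : 0 < height α u r w i 0) :
    slack v r w (dualVertex α u r w i) k = if k = i then r / height α u r w i 0 else 0 := by
  have h1 : ∑ j, ((r : ℝ) * v k j + w j) * u i j + height α u r w i 0 =
      r * (if k = i then 1 else 0) := by
    rw [← h.apply_vertex, height, mul_add, Finset.mul_sum, add_left_comm, ← Finset.sum_add_distrib]
    congr 1
    refine Finset.sum_congr rfl fun j _ => ?_
    simp only [Pi.zero_apply]
    ring
  simp only [slack, dualVertex, mul_div_assoc', mul_neg, ← Finset.sum_div, Finset.sum_neg_distrib]
  rw [eq_sub_of_add_eq h1]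
  split_ifs <;> field_simp <;> ring

theorem polarDual_dilate_eq (h : IsBarycentricDual v α u) {r : ℕ} (hr : 1 ≤ r) (w : Fin d → ℤ)
    (hpos : ∀ i, 0 < height α u r w i 0) :
    polarDual (dilate v r w) = convexHull ℝ (Set.range (dualVertex α u r w)) := by
  have hr0 : (0 : ℝ) < r := by exact_mod_cast hr
  ext y
  rw [mem_convexHull_range_iff, mem_polarDual_dilate_iff]
  constructor
  · intro hy
    refine ⟨fun k => slack v r w y k * height α u r w k 0 / r,
      fun k => div_nonneg (mul_nonneg (hy k) (hpos k).le) hr0.le, ?_, ?_⟩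
    · rw [← Finset.sum_div, h.sum_slack_mul_height_zero, div_self hr0.ne']
    · ext j
      have : ∀ k, slack v r w y k * height α u r w k 0 / r * dualVertex α u r w k j =
          -(slack v r w y k * u k j) / r := fun k => by
        have := (hpos k).ne'
        simp only [dualVertex]
        field_simp
      simp only [Finset.sum_apply, Pi.smul_apply, smul_eq_mul, this, ← Finset.sum_div,
        Finset.sum_neg_distrib, h.sum_slack_mul_linear]
      field_simp
  · rintro ⟨t, ht, ht1, rfl⟩ k
    have : slack v r w (∑ i, t i • dualVertex α u r w i) k =
        ∑ i, t i * slack v r w (dualVertex α u r w i) k := by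
      simp only [slack, mul_sub, mul_one, Finset.sum_sub_distrib, ht1, Finset.sum_apply,
        Pi.smul_apply, smul_eq_mul, Finset.mul_sum]
      rw [Finset.sum_comm]
      simp only [mul_left_comm]
    rw [this]
    refine Finset.sum_nonneg fun i _ => mul_nonneg (ht i) ?_
    rw [h.slack_dualVertex r w i k (hpos i)]
    split_ifs
    exacts [div_nonneg hr0.le (hpos i).le, le_rfl]

theorem dualVertex_mem_extremePoints (h : IsBarycentricDual v α u) {r : ℕ} (hr : 1 ≤ r)
    (w : Fin d → ℤ) (i : Fin (d + 1)) (hi : 0 < height α u r w i 0) :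
    dualVertex α u r w i ∈ (polarDual (dilate v r w)).extremePoints ℝ := by
  have hr0 : (0 : ℝ) < r := by exact_mod_cast hr
  rw [mem_extremePoints_iff_left]
  refine ⟨(mem_polarDual_dilate_iff r w _).2 fun k => ?_, fun x hx y hy hxy => ?_⟩
  · rw [h.slack_dualVertex r w i k hi]
    split_ifs
    exacts [div_nonneg hr0.le hi.le, le_rfl]
  · rw [mem_polarDual_dilate_iff] at hx hy
    obtain ⟨a, b, ha, hb, hab, hz⟩ := hxy
    have hzero : ∀ k ≠ i, slack v r w x k = 0 := by
      intro k hk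
      have h1 : slack v r w (dualVertex α u r w i) k = a * slack v r w x k + b * slack v r w y k := by
        rw [← hz]
        simp only [slack, mul_sub, mul_one, Pi.add_apply, Pi.smul_apply, smul_eq_mul, mul_add,
          Finset.sum_add_distrib, Finset.mul_sum, mul_left_comm a, mul_left_comm b]
        rw [← hab]
        ring
      rw [h.slack_dualVertex r w i k hi, if_neg hk] at h1
      have h2 := mul_nonneg hb.le (hy k)
      have h3 := mul_nonneg ha.le (hx k)
      have h4 : a * slack v r w x k = 0 := by linarith
      exact (mul_eq_zero.1 h4).resolve_left ha.ne'
    have hc := h.sum_slack_mul_height_zero r w x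
    rw [Fintype.sum_eq_single i fun k hk => by rw [hzero k hk, zero_mul]] at hc
    ext j
    have hl := h.sum_slack_mul_linear r w x j
    rw [Fintype.sum_eq_single i fun k hk => by rw [hzero k hk, zero_mul]] at hl
    rw [dualVertex, eq_div_iff hi.ne']
    refine mul_left_cancel₀ hr0.ne' ?_
    linear_combination height α u r w i 0 * hl - u i j * hc

theorem exists_int_mul_height {p : ℕ} (hα : ∀ i, ∃ n : ℤ, p * α i = n)
    (hu : ∀ i j, ∃ n : ℤ, p * u i j = n) (r : ℕ) (w x : Fin d → ℤ) (i : Fin (d + 1)) :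
    ∃ n : ℤ, p * height α u r w i (toReal x) = n := by
  choose a ha using hα
  choose b hb using hu
  refine ⟨r * a i + ∑ j, (x j - w j) * b i j, ?_⟩
  push_cast
  rw [height, mul_add, Finset.mul_sum, ← ha]
  simp only [mul_left_comm (p : ℝ), hb, toReal]

end IsBarycentricDual

theorem natAbs_det_vertexMatrix {d p : ℕ} (v : Fin (d + 1) → Fin d → ℤ)
    (hvol : (Nat.factorial d : ENNReal) * volume (simplexOf v) = (p : ENNReal)) :
    (vertexMatrix v).det.natAbs = p := by
  have hf : (0 : ℝ) < d.factorial := by positivity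
  rw [volume_simplexOf, ← ENNReal.ofReal_natCast, ← ENNReal.ofReal_mul hf.le,
    mul_div_cancel₀ _ hf.ne', ← ENNReal.ofReal_natCast,
    ENNReal.ofReal_eq_ofReal_iff (abs_nonneg _) (Nat.cast_nonneg _)] at hvol
  rw [← Int.cast_abs, Int.abs_eq_natAbs] at hvol
  exact_mod_cast hvol

theorem lambdaSet_eq_range {d p : ℕ} (hp : p.Prime) (v : Fin (d + 1) → Fin d → ℤ)
    (hdet : (vertexMatrix v).det.natAbs = p) {r : ℕ} (hr : d + 1 = r * p)
    (hv : ∀ j, ∃ n : ℤ, ∑ i, 1 / (p : ℝ) * (v i j : ℝ) = n) :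
    LambdaSet v = Set.range fun k : ℤ =>
      k • fun _ : Fin (d + 1) => ((1 / (p : ℝ) : ℝ) : AddCircle (1 : ℝ)) := by
  have hp0 : (p : ℝ) ≠ 0 := by exact_mod_cast hp.ne_zero
  have hr' : ((d : ℝ) + 1) * (1 / p) = r := by
    rw [mul_one_div, div_eq_iff hp0]
    exact_mod_cast hr
  choose n hn using hv
  obtain ⟨α, u, h, -, -⟩ := exists_isBarycentricDual hp.ne_zero v hdet
  have hvecMul : ∀ (z : Fin (d + 1) → ℤ) (s : ℤ) (y : Fin d → ℤ),
      (vertexMatrix v).vecMulLinear z = Fin.cons s y →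
      ∑ i, (z i : ℝ) = s ∧ ∀ j, ∑ i, (z i : ℝ) * v i j = y j := by
    intro z s y hz
    have h0 := congrFun hz 0
    have hs := fun j : Fin d => congrFun hz j.succ
    simp only [Matrix.vecMulLinear_apply, Matrix.vecMul, dotProduct, vertexMatrix, Matrix.of_apply,
      Fin.cons_zero, Fin.cons_succ, mul_one] at h0 hs
    exact ⟨by exact_mod_cast h0, fun j => by exact_mod_cast hs j⟩
  ext lam
  constructor
  · rintro ⟨mu, hmu, hmuv, m, hm⟩
    choose y hy using hmuv
    have hx : (Fin.cons (r : ℤ) n : Fin (d + 1) → ℤ) ∉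
        LinearMap.range (vertexMatrix v).vecMulLinear := by
      rintro ⟨z, hz⟩
      obtain ⟨hz0, hzs⟩ := hvecMul z r n hz
      have hz1 := congrFun (h.combination_injective (s := fun i => (z i : ℝ))
        (t := fun _ => 1 / (p : ℝ)) (by rw [hz0]; simp [← hr']) fun j => by rw [hzs, hn]) 0
      have hz2 : (p : ℤ) * z 0 = 1 := by
        have : (p : ℝ) * z 0 = 1 := by simp only [hz1]; field_simp
        exact_mod_cast this
      exact hp.one_lt.ne' (by simpa using Int.isUnit_iff_natAbs_eq.1 (IsUnit.of_mul_eq_one _ hz2))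
    obtain ⟨k, z, hz⟩ := exists_sub_smul_mem_range_vecMul (vertexMatrix v) hp hdet _ hx
      (Fin.cons m y)
    obtain ⟨hz0, hzs⟩ := hvecMul z (m - k * r) (fun j => y j - k * n j) (by
      rw [hz]
      ext j
      refine Fin.cases ?_ (fun j => ?_) j <;> simp)
    have hmuz := h.combination_injective (s := mu) (t := fun i => z i + k * (1 / (p : ℝ)))
      (by
        rw [Finset.sum_add_distrib, hz0, hm]
        simp only [Finset.sum_const, Finset.card_univ, Fintype.card_fin, nsmul_eq_mul]
        push_cast
        linear_combination -(k : ℝ) * hr')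
      (fun j => by
        have hk : ∑ i, (k : ℝ) * (1 / p) * v i j = k * n j := by
          rw [← hn, Finset.mul_sum]
          simp only [mul_assoc]
        simp only [add_mul, Finset.sum_add_distrib, hzs, hy, hk]
        push_cast
        ring)
    refine ⟨k, funext fun i => ?_⟩
    simp only [← hmu, hmuz]
    rw [Pi.smul_apply, ← AddCircle.coe_zsmul, zsmul_eq_mul, AddCircle.coe_add]
    have : ((z i : ℝ) : AddCircle (1 : ℝ)) = 0 :=
      (AddCircle.coe_eq_zero_iff _).2 ⟨z i, by simp⟩
    rw [this, zero_add]
  · rintro ⟨k, rfl⟩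
    refine ⟨fun _ => k * (1 / p), fun i => ?_, fun j => ⟨k * n j, ?_⟩, k * r, ?_⟩
    · dsimp only
      rw [Pi.smul_apply, ← AddCircle.coe_zsmul, zsmul_eq_mul]
    · push_cast
      rw [← hn, Finset.mul_sum]
      simp only [mul_assoc]
    · push_cast
      rw [← hr']
      simp
      ring

theorem isLatticePyramid_of_integral_linear {d : ℕ} {v : Fin (d + 1) → Fin d → ℤ}
    {α : Fin (d + 1) → ℝ} {u : Fin (d + 1) → Fin d → ℝ} (h : IsBarycentricDual v α u)
    (hd : d ≠ 0) (i : Fin (d + 1)) (z : Fin d → ℤ) (hz : ∀ j, u i j = z j) :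
    IsLatticePyramid (simplexOf v) := by
  obtain ⟨n, rfl⟩ := Nat.exists_eq_succ_of_ne_zero hd
  refine isLatticePyramid_of_dual_vector v i z fun k hk => ?_
  have h1 := h.apply_vertex k i
  have h2 := h.apply_vertex i i
  rw [if_neg hk] at h1
  rw [if_pos rfl] at h2
  have : ∑ j, (z j : ℝ) * (v i j - v k j) = 1 := by
    simp only [← hz, mul_comm (u i _), sub_mul, Finset.sum_sub_distrib]
    linarith
  exact_mod_cast this

open IsBarycentricDual in
theorem height_zero_eq_of_isReflexive {d p : ℕ} (hp : p.Prime) {v : Fin (d + 1) → Fin d → ℤ}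
    {α : Fin (d + 1) → ℝ} {u : Fin (d + 1) → Fin d → ℝ} (h : IsBarycentricDual v α u)
    (hα : ∀ i, ∃ n : ℤ, p * α i = n) (hu : ∀ i j, ∃ n : ℤ, p * u i j = n)
    (hd : d ≠ 0) (hpyr : ¬ IsLatticePyramid (simplexOf v)) {r : ℕ} (hr : 1 ≤ r) (w : Fin d → ℤ)
    (href : IsReflexive (dilate v r w)) (i : Fin (d + 1)) :
    height α u r w i 0 = 1 / p := by
  have hp0 : (0 : ℝ) < p := by exact_mod_cast hp.pos
  obtain ⟨h0, -, V, hV⟩ := href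
  have hpos := (h.mem_interior_dilate_iff hd hr w 0).1 h0 i
  have hext := h.dualVertex_mem_extremePoints hr w i hpos
  rw [hV] at hext
  obtain ⟨z, -, hz⟩ := extremePoints_convexHull_subset hext
  have huz : ∀ j, u i j = -(height α u r w i 0 * z j) := fun j => by
    have := congrFun hz j
    simp only [toReal, dualVertex] at this
    rw [this]
    field_simp
  have : Nontrivial (Fin (d + 1)) := Fin.nontrivial_iff_two_le.2 (by omega)
  obtain ⟨k, hk⟩ := exists_ne i
  have hm : height α u r w i 0 * ((∑ j, (v k j - v i j) * z j : ℤ) : ℝ) = 1 := by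
    have h1 := h.apply_vertex k i
    have h2 := h.apply_vertex i i
    rw [if_neg hk] at h1
    rw [if_pos rfl] at h2
    simp only [huz, mul_neg, Finset.sum_neg_distrib, mul_left_comm _ (height α u r w i 0),
      ← Finset.mul_sum] at h1 h2
    push_cast
    simp only [sub_mul, Finset.sum_sub_distrib]
    linarith
  set m : ℤ := ∑ j, (v k j - v i j) * z j
  obtain ⟨a, ha⟩ := exists_int_mul_height hα hu r w 0 i
  have ha' : p * height α u r w i 0 = a := by
    rw [← ha]
    congr
    ext
    simp [toReal]
  have ham : a * m = p := by
    have : (a : ℝ) * m = p := by rw [← ha', mul_assoc, hm, mul_one]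
    exact_mod_cast this
  have ha0 : 0 < a := by
    have : (0 : ℝ) < a := ha' ▸ mul_pos hp0 hpos
    exact_mod_cast this
  lift a to ℕ using ha0.le
  have hap : a ∣ p := Int.natCast_dvd_natCast.1 ⟨m, ham.symm⟩
  rcases (Nat.dvd_prime hp).1 hap with rfl | rfl
  · rw [eq_div_iff hp0.ne', mul_comm]
    simpa using ha'
  · have hone : height α u r w i 0 = 1 := mul_left_cancel₀ hp0.ne' (by simpa using ha')
    exact absurd (isLatticePyramid_of_integral_linear h hd i (fun j => -z j) fun j => by
      rw [huz, hone]
      simp) hpyr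

open IsBarycentricDual in
theorem isReflexive_of_height_zero_eq {d p : ℕ} (hp : p ≠ 0) {v : Fin (d + 1) → Fin d → ℤ}
    {α : Fin (d + 1) → ℝ} {u : Fin (d + 1) → Fin d → ℝ} (h : IsBarycentricDual v α u)
    (hα : ∀ i, ∃ n : ℤ, p * α i = n) (hu : ∀ i j, ∃ n : ℤ, p * u i j = n)
    (hd : d ≠ 0) {r : ℕ} (hr : 1 ≤ r) (w : Fin d → ℤ)
    (hheight : ∀ i, height α u r w i 0 = 1 / p) : IsReflexive (dilate v r w) := by
  have hp0 : (0 : ℝ) < p := by exact_mod_cast hp.bot_lt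
  have hpos : ∀ i, 0 < height α u r w i 0 := fun i => by rw [hheight]; positivity
  refine ⟨(h.mem_interior_dilate_iff hd hr w 0).2 hpos, fun x hx hlat => ?_, ?_⟩
  · choose y hy using hlat
    obtain rfl : x = toReal y := funext hy
    rw [h.mem_interior_dilate_iff hd hr w] at hx
    have hge : ∀ i, height α u r w i 0 ≤ height α u r w i (toReal y) := by
      intro i
      obtain ⟨n, hn⟩ := exists_int_mul_height hα hu r w y i
      have : (0 : ℝ) < n := hn ▸ mul_pos hp0 (hx i)
      have : (1 : ℝ) ≤ n := by exact_mod_cast this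
      rw [hheight, div_le_iff₀' hp0, hn]
      exact this
    have heq := (Finset.sum_eq_sum_iff_of_le fun i (_ : i ∈ Finset.univ) => hge i).1
      (by rw [h.sum_height, h.sum_height])
    ext l
    have h1 := h.sum_height_mul r w (toReal y) l
    have h2 := h.sum_height_mul r w 0 l
    simp only [← heq _ (Finset.mem_univ _), h2] at h1
    exact (sub_left_injective h1).symm
  · choose b hb using hu
    refine ⟨Finset.univ.image fun i j => -b i j, ?_⟩
    rw [h.polarDual_dilate_eq hr w hpos, Finset.coe_image, Finset.coe_univ, Set.image_univ,
      ← Set.range_comp]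
    congr 2
    ext i j
    simp only [dualVertex, hheight, Function.comp, toReal, Int.cast_neg, ← hb]
    field_simp

/-- a `d`-dimensional lattice simplex of normalized volume a prime `p`,
not a lattice pyramid, is Gorenstein of index `r` iff `d = r·p - 1` and `Λ_Δ` is the
cyclic group generated by `(1/p, …, 1/p)`. -/
theorem statement10 {d : ℕ} (p : ℕ) (hp : p.Prime)
    (v : Fin (d + 1) → Fin d → ℤ)
    (hΔ : AffineIndependent ℝ fun i => toReal (v i))
    (hvol : (Nat.factorial d : ENNReal) * volume (simplexOf v) = (p : ENNReal))
    (hpyr : ¬ IsLatticePyramid (simplexOf v)) (r : ℕ) (hr : 1 ≤ r) :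
    IsGorenstein (simplexOf v) r ↔
      (d + 1 = r * p ∧
        LambdaSet v = Set.range fun k : ℤ =>
          k • fun _ : Fin (d + 1) => ((1 / (p : ℝ) : ℝ) : AddCircle (1 : ℝ))) := by
  have hdet := natAbs_det_vertexMatrix v hvol
  have hd : d ≠ 0 := by
    rintro rfl
    rw [det_vertexMatrix, Matrix.det_fin_zero] at hdet
    exact hp.one_lt.ne hdet
  have hp0 : (p : ℝ) ≠ 0 := by exact_mod_cast hp.ne_zero
  obtain ⟨α, u, h, hα, hu⟩ := exists_isBarycentricDual hp.ne_zero v hdet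
  constructor
  · rintro ⟨w, href⟩
    have hheight := height_zero_eq_of_isReflexive hp h hα hu hd hpyr hr w href
    have hdr : d + 1 = r * p := by
      have hsum := h.sum_height r w 0
      simp only [hheight, Finset.sum_const, Finset.card_univ, Fintype.card_fin, nsmul_eq_mul,
        mul_one_div] at hsum
      rw [div_eq_iff hp0] at hsum
      exact_mod_cast hsum
    refine ⟨hdr, lambdaSet_eq_range hp v hdet hdr fun j => ⟨-w j, ?_⟩⟩
    simpa [hheight] using h.sum_height_mul r w 0 j
  · rintro ⟨hdr, hΛ⟩
    have hmem : (fun _ : Fin (d + 1) => ((1 / (p : ℝ) : ℝ) : AddCircle (1 : ℝ))) ∈ LambdaSet v := by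
      rw [hΛ]
      exact ⟨1, one_smul _ _⟩
    obtain ⟨mu, hmu, hmuv, -⟩ := hmem
    choose n hn using hmuv
    have hdiff : ∀ i, ∃ m : ℤ, 1 / (p : ℝ) = mu i + m := fun i => by
      have : ((1 / (p : ℝ) - mu i : ℝ) : AddCircle (1 : ℝ)) = 0 := by
        rw [AddCircle.coe_sub, hmu, sub_self]
      obtain ⟨m, hm⟩ := (AddCircle.coe_eq_zero_iff _).1 this
      exact ⟨m, by simp at hm ⊢; linarith⟩
    choose m hm using hdiff
    refine ⟨fun j => -(n j + ∑ i, m i * v i j), isReflexive_of_height_zero_eq hp.ne_zero h hα hu hd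
      hr _ (h.height_combination r _ 0 _ ?_ fun j => ?_)⟩
    · simp only [Finset.sum_const, Finset.card_univ, Fintype.card_fin, nsmul_eq_mul, mul_one_div]
      rw [div_eq_iff hp0]
      exact_mod_cast hdr
    · rw [Finset.sum_congr rfl fun i _ => by rw [hm i]]
      simp only [add_mul, Finset.sum_add_distrib, hn]
      push_cast
      simp
end
end

section
/- Let p ≠ q be primes and Δ ⊂ ℝ^d a d-dimensional lattice simplex of normalized volume pq that is not a lattice pyramid. Then Δ is Gorenstein of index r if and only if there exist nonnegative integers s_1, s_2, s_3 with s_1 + s_2 + s_3 = d + 1, rpq = s_1 q + s_2 p + s_3, and Λ_Δ is generated by the element with s_1 entries 1/p, then s_2 entries 1/q, then s_3 entries 1/(pq), for some ordering of the vertices. -/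
open scoped BigOperators
open MeasureTheory

noncomputable section

/-- The element of `(ℝ/ℤ)^{d+1}` with `s₁` entries `1/p`, then `s₂` entries `1/q`,
and remaining entries `1/(pq)`. -/
def genPQ (d s₁ s₂ p q : ℕ) : Fin (d + 1) → AddCircle (1 : ℝ) := fun i =>
  (((if (i : ℕ) < s₁ then 1 / (p : ℝ)
     else if (i : ℕ) < s₁ + s₂ then 1 / (q : ℝ)
     else 1 / ((p : ℝ) * (q : ℝ))) : ℝ) : AddCircle (1 : ℝ))

theorem toReal_dotProduct {d : ℕ} (x y : Fin d → ℤ) :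
    toReal x ⬝ᵥ toReal y = ((x ⬝ᵥ y : ℤ) : ℝ) := by
  simp [toReal, dotProduct]

theorem AffineIndependent.exists_affineBasis {d : ℕ} {u : Fin (d + 1) → Fin d → ℝ}
    (hu : AffineIndependent ℝ u) :
    ∃ b : AffineBasis (Fin (d + 1)) ℝ (Fin d → ℝ), ⇑b = u :=
  ⟨⟨u, hu, by rw [hu.affineSpan_eq_top_iff_card_eq_finrank_add_one]; simp⟩, rfl⟩

theorem AffineBasis.dotProduct_eq_sum {d : ℕ} (b : AffineBasis (Fin (d + 1)) ℝ (Fin d → ℝ))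
    (x z : Fin d → ℝ) : x ⬝ᵥ z = ∑ i, b.coord i x * (b i ⬝ᵥ z) := by
  conv_lhs => rw [← b.linear_combination_coord_eq_self x]
  rw [sum_dotProduct]
  exact Finset.sum_congr rfl fun i _ => smul_dotProduct _ _ _

theorem AffineBasis.dotProduct_of_eq_one {d : ℕ}
    (b : AffineBasis (Fin (d + 1)) ℝ (Fin d → ℝ)) {i : Fin (d + 1)} (hi : b.coord i 0 ≠ 0)
    {z : Fin d → ℝ} (hz : ∀ j, j ≠ i → b j ⬝ᵥ z = 1) (x : Fin d → ℝ) :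
    x ⬝ᵥ z = 1 - b.coord i x / b.coord i 0 := by
  have key : ∀ x, x ⬝ᵥ z = 1 - b.coord i x * (1 - b i ⬝ᵥ z) := by
    intro x
    have h : ∀ j, b.coord j x * (b j ⬝ᵥ z)
        = b.coord j x - if j = i then b.coord i x * (1 - b i ⬝ᵥ z) else 0 := by
      intro j
      by_cases hj : j = i
      · subst hj; simp; ring
      · simp [hj, hz j hj]
    rw [b.dotProduct_eq_sum, Finset.sum_congr rfl fun j _ => h j, Finset.sum_sub_distrib,
      b.sum_coord_apply_eq_one]
    simp
  have h0 := key 0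
  rw [zero_dotProduct] at h0
  rw [key x, div_eq_mul_inv]
  congr 2
  exact eq_inv_of_mul_eq_one_right (by linarith)

theorem AffineBasis.exists_dotProduct_eq {d : ℕ}
    (b : AffineBasis (Fin (d + 1)) ℝ (Fin d → ℝ)) {i : Fin (d + 1)} (hi : b.coord i 0 ≠ 0) :
    ∃ z : Fin d → ℝ, ∀ x, x ⬝ᵥ z = 1 - b.coord i x / b.coord i 0 := by
  set f : (Fin d → ℝ) →ₗ[ℝ] ℝ := -(b.coord i 0)⁻¹ • (b.coord i).linear with hf
  refine ⟨fun k => f (fun j => if k = j then 1 else 0), fun x => ?_⟩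
  have h1 := LinearMap.pi_apply_eq_sum_univ f x
  have h2 : b.coord i x = (b.coord i).linear x + b.coord i 0 := by
    rw [(b.coord i).decomp]; simp
  have h3 : f x = 1 - b.coord i x / b.coord i 0 := by
    rw [h2, hf]
    simp
    field_simp
    ring
  rw [← h3, h1]
  simp [dotProduct]

theorem AffineBasis.coord_nonneg_of_mem_convexHull {d : ℕ}
    (b : AffineBasis (Fin (d + 1)) ℝ (Fin d → ℝ)) {x : Fin d → ℝ}
    (hx : x ∈ convexHull ℝ (Set.range b)) (i : Fin (d + 1)) : 0 ≤ b.coord i x := by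
  rw [b.convexHull_eq_nonneg_coord] at hx
  exact hx i

theorem mem_polarDual_iff {d : ℕ} {ι : Type*} (u : ι → Fin d → ℝ) (z : Fin d → ℝ) :
    z ∈ polarDual (convexHull ℝ (Set.range u)) ↔ ∀ i, u i ⬝ᵥ z ≤ 1 := by
  refine ⟨fun h i => h _ (subset_convexHull ℝ _ ⟨i, rfl⟩), fun h x hx => ?_⟩
  have hconv : Convex ℝ {x : Fin d → ℝ | x ⬝ᵥ z ≤ 1} :=
    convex_halfSpace_le ⟨fun x y => add_dotProduct x y z, fun c x => smul_dotProduct c x z⟩ 1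
  exact convexHull_min (by rintro _ ⟨i, rfl⟩; exact h i) hconv hx

theorem isReflexive_convexHull_iff {d : ℕ} (b : AffineBasis (Fin (d + 1)) ℝ (Fin d → ℝ)) :
    IsReflexive (convexHull ℝ (Set.range b)) ↔
      (∀ i, 0 < b.coord i 0) ∧ ∃ y : Fin (d + 1) → Fin d → ℤ,
        ∀ i x, x ⬝ᵥ toReal (y i) = 1 - b.coord i x / b.coord i 0 := by
  have hint : ∀ x, x ∈ interior (convexHull ℝ (Set.range b)) ↔ ∀ i, 0 < b.coord i x := by
    intro x
    rw [b.interior_convexHull]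
    rfl
  constructor
  · rintro ⟨h0, -, V, hV⟩
    have hpos := (hint 0).1 h0
    refine ⟨hpos, ?_⟩
    suffices h : ∀ i, ∃ y : Fin d → ℤ, ∀ x, x ⬝ᵥ toReal y = 1 - b.coord i x / b.coord i 0 by
      choose y hy using h
      exact ⟨y, hy⟩
    intro i
    obtain ⟨z, hz⟩ := b.exists_dotProduct_eq (hpos i).ne'
    have hzj : ∀ j, j ≠ i → b j ⬝ᵥ z = 1 := by
      intro j hj
      rw [hz, b.coord_apply_ne hj.symm]
      simp
    have hzmem : z ∈ polarDual (convexHull ℝ (Set.range b)) := by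
      rw [mem_polarDual_iff]
      intro j
      rw [hz]
      have := b.coord_nonneg_of_mem_convexHull (subset_convexHull ℝ _ ⟨j, rfl⟩) i
      have := div_nonneg this (hpos i).le
      linarith
    rw [hV] at hzmem
    have hconv : ConvexOn ℝ Set.univ fun y : Fin d → ℝ => ∑ j ∈ Finset.univ.erase i, b j ⬝ᵥ y := by
      refine LinearMap.convexOn (E := Fin d → ℝ) (β := ℝ)
        { toFun := fun y => ∑ j ∈ Finset.univ.erase i, b j ⬝ᵥ y
          map_add' := ?_, map_smul' := ?_ } convex_univ
      · intro x y; simp [dotProduct_add, Finset.sum_add_distrib]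
      · intro c y; simp only [dotProduct_smul, ← Finset.smul_sum, RingHom.id_apply]
    obtain ⟨_, ⟨y, hyV, rfl⟩, hy⟩ :=
      (hconv.subset (Set.subset_univ _) (convex_convexHull ℝ _)).exists_ge_of_mem_convexHull
        (subset_convexHull ℝ (toReal '' (V : Set (Fin d → ℤ)))) hzmem
    have hymem : toReal y ∈ polarDual (convexHull ℝ (Set.range b)) := by
      rw [hV]
      exact subset_convexHull ℝ _ ⟨y, hyV, rfl⟩
    rw [mem_polarDual_iff] at hymem
    refine ⟨y, b.dotProduct_of_eq_one (hpos i).ne' fun j hj => ?_⟩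
    have hle : ∀ j ∈ Finset.univ.erase i, b j ⬝ᵥ toReal y ≤ b j ⬝ᵥ z := by
      intro j hj
      rw [hzj j (Finset.ne_of_mem_erase hj)]
      exact hymem j
    have heq := (Finset.sum_eq_sum_iff_of_le hle).1 (le_antisymm (Finset.sum_le_sum hle) hy)
    rw [heq j (by simp [hj]), hzj j hj]
  · rintro ⟨hpos, y, hy⟩
    refine ⟨(hint 0).2 hpos, ?_, Finset.univ.image y, ?_⟩
    · intro x hx hlat
      rw [hint] at hx
      choose n hn using hlat
      obtain rfl : x = toReal n := funext hn
      have hge : ∀ i ∈ Finset.univ, b.coord i 0 ≤ b.coord i (toReal n) := by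
        intro i _
        have h := hy i (toReal n)
        rw [toReal_dotProduct] at h
        have h1 : 0 < b.coord i (toReal n) / b.coord i 0 := div_pos (hx i) (hpos i)
        have h2 : ((n ⬝ᵥ y i : ℤ) : ℝ) < 1 := by linarith
        have h3 : n ⬝ᵥ y i ≤ 0 := by
          have : n ⬝ᵥ y i < 1 := by exact_mod_cast h2
          omega
        have h4 : ((n ⬝ᵥ y i : ℤ) : ℝ) ≤ 0 := by exact_mod_cast h3
        have h5 : 1 ≤ b.coord i (toReal n) / b.coord i 0 := by linarith
        rwa [one_le_div (hpos i)] at h5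
      have heq := (Finset.sum_eq_sum_iff_of_le hge).1
        (by rw [b.sum_coord_apply_eq_one, b.sum_coord_apply_eq_one])
      rw [← b.linear_combination_coord_eq_self (toReal n),
        ← b.linear_combination_coord_eq_self 0]
      exact Finset.sum_congr rfl fun i hi => by rw [heq i hi]
    · have himg : toReal '' ((Finset.univ.image y : Finset (Fin d → ℤ)) : Set (Fin d → ℤ))
          = Set.range fun i => toReal (y i) := by
        ext z; simp
      rw [himg]
      apply Set.Subset.antisymm
      · intro z hz
        rw [mem_polarDual_iff] at hz
        set t : Fin (d + 1) → ℝ := fun i => b.coord i 0 * (1 - b i ⬝ᵥ z) with ht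
        have hsum : ∑ i, t i = 1 := by
          have h := b.dotProduct_eq_sum 0 z
          rw [zero_dotProduct] at h
          simp only [ht, mul_sub, mul_one, Finset.sum_sub_distrib, b.sum_coord_apply_eq_one, ← h]
          simp
        have hzt : z = ∑ i, t i • toReal (y i) := by
          apply dotProduct_eq
          intro x
          rw [dotProduct_comm z, dotProduct_comm _ x, dotProduct_sum]
          have : ∀ i, x ⬝ᵥ (t i • toReal (y i))
              = t i - (b.coord i x - b.coord i x * (b i ⬝ᵥ z)) := by
            intro i
            have := (hpos i).ne'
            rw [dotProduct_smul, hy, ht]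
            simp
            field_simp
          rw [Finset.sum_congr rfl fun i _ => this i, Finset.sum_sub_distrib,
            Finset.sum_sub_distrib, hsum, b.sum_coord_apply_eq_one, ← b.dotProduct_eq_sum]
          ring
        rw [hzt]
        exact (convex_convexHull ℝ _).sum_mem
          (fun i _ => mul_nonneg (hpos i).le (sub_nonneg.2 (hz i))) hsum
          fun i _ => subset_convexHull ℝ _ ⟨i, rfl⟩
      · have hconv : Convex ℝ (polarDual (convexHull ℝ (Set.range b))) := by
          intro z hz z' hz' s t hs ht hst
          rw [mem_polarDual_iff] at *
          intro i
          rw [dotProduct_add, dotProduct_smul, dotProduct_smul, smul_eq_mul, smul_eq_mul]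
          nlinarith [hz i, hz' i]
        refine convexHull_min ?_ hconv
        rintro _ ⟨i, rfl⟩
        rw [mem_polarDual_iff]
        intro j
        rw [hy]
        have := b.coord_nonneg_of_mem_convexHull (subset_convexHull ℝ _ ⟨j, rfl⟩) i
        have := div_nonneg this (hpos i).le
        linarith

theorem AffineBasis.coord_eq_of_sum_smul_eq {d : ℕ}
    (b : AffineBasis (Fin (d + 1)) ℝ (Fin d → ℝ)) {β : Fin (d + 1) → ℝ} {x : Fin d → ℝ}
    (hβ : ∑ i, β i = 1) (hx : ∑ i, β i • b i = x) (i : Fin (d + 1)) : b.coord i x = β i := by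
  rw [← hx, ← Finset.affineCombination_eq_linear_combination _ _ _ hβ,
    b.coord_apply_combination_of_mem (Finset.mem_univ i) hβ]

theorem exists_affineBasis_dilate {d : ℕ} {v : Fin (d + 1) → Fin d → ℤ}
    (hv : AffineIndependent ℝ fun i => toReal (v i)) {r : ℕ} (hr : 1 ≤ r) (w : Fin d → ℤ) :
    ∃ b : AffineBasis (Fin (d + 1)) ℝ (Fin d → ℝ),
      (∀ i, b i = (r : ℝ) • toReal (v i) + toReal w) ∧
      (fun x => (r : ℝ) • x + toReal w) '' simplexOf v = convexHull ℝ (Set.range b) := by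
  set f : (Fin d → ℝ) →ᵃ[ℝ] (Fin d → ℝ) :=
    (r : ℝ) • AffineMap.id ℝ _ + AffineMap.const ℝ _ (toReal w) with hf
  have hfx : ∀ x, f x = (r : ℝ) • x + toReal w := fun x => by simp [hf]
  have hr0 : (r : ℝ) ≠ 0 := by positivity
  have hinj : Function.Injective f := by
    intro x y hxy
    rw [hfx, hfx] at hxy
    exact smul_right_injective _ hr0 (add_right_cancel hxy)
  obtain ⟨b, hb⟩ := (hv.map' f hinj).exists_affineBasis
  refine ⟨b, fun i => by rw [hb, Function.comp_apply, hfx], ?_⟩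
  have : (fun x => (r : ℝ) • x + toReal w) = f := funext fun x => (hfx x).symm
  rw [this, simplexOf, f.image_convexHull, hb, Set.range_comp]

theorem mul_eq_of_dual {d : ℕ} {v : Fin (d + 1) → Fin d → ℤ} {c m : ℤ} {y : Fin d → ℤ}
    {i : Fin (d + 1)} (h : ∀ j, c - v j ⬝ᵥ y = if j = i then m else 0)
    (ν : Fin (d + 1) → ℝ) :
    ν i * m = c * ∑ j, ν j - ∑ k, (∑ j, ν j * (v j k : ℝ)) * y k := by
  have h1 : ∑ j, ν j * ((c - v j ⬝ᵥ y : ℤ) : ℝ) = ν i * m := by simp [h]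
  rw [← h1]
  simp only [Finset.sum_mul]
  rw [Finset.sum_comm, Finset.mul_sum, ← Finset.sum_sub_distrib]
  refine Finset.sum_congr rfl fun j _ => ?_
  simp only [dotProduct, mul_assoc, ← Finset.mul_sum]
  push_cast
  ring

theorem exists_int_mul_eq_of_dual {d : ℕ} {v : Fin (d + 1) → Fin d → ℤ} {c m : ℤ}
    {y : Fin d → ℤ} {i : Fin (d + 1)} (h : ∀ j, c - v j ⬝ᵥ y = if j = i then m else 0)
    {ν : Fin (d + 1) → ℝ} (hν : ∀ k, ∃ n : ℤ, ∑ j, ν j * (v j k : ℝ) = n)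
    (hs : ∃ n : ℤ, ∑ j, ν j = n) : ∃ n : ℤ, ν i * m = n := by
  choose n hn using hν
  obtain ⟨N, hN⟩ := hs
  refine ⟨c * N - ∑ k, n k * y k, ?_⟩
  rw [mul_eq_of_dual h, hN]
  simp [hn]

theorem zsmul_eq_zero_of_dual {d : ℕ} {v : Fin (d + 1) → Fin d → ℤ} {c m : ℤ}
    {y : Fin d → ℤ} {i : Fin (d + 1)} (h : ∀ j, c - v j ⬝ᵥ y = if j = i then m else 0)
    {lam : Fin (d + 1) → AddCircle (1 : ℝ)} (hlam : lam ∈ LambdaSet v) : m • lam i = 0 := by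
  obtain ⟨ν, hν, h1, h2⟩ := hlam
  obtain ⟨n, hn⟩ := exists_int_mul_eq_of_dual h h1 h2
  rw [← hν i, ← AddCircle.coe_zsmul, AddCircle.coe_eq_zero_iff]
  exact ⟨n, by simp [← hn, mul_comm]⟩

theorem IsGorenstein.exists_dual {d : ℕ} {v : Fin (d + 1) → Fin d → ℤ} (hd : 0 < d)
    (hv : AffineIndependent ℝ fun i => toReal (v i)) {r : ℕ} (hr : 1 ≤ r)
    (h : IsGorenstein (simplexOf v) r) :
    ∃ (μ : Fin (d + 1) → ℝ) (w : Fin d → ℤ) (m c : Fin (d + 1) → ℤ)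
      (y : Fin (d + 1) → Fin d → ℤ),
      ∑ i, μ i = r ∧ (∀ k, ∑ i, μ i * (v i k : ℝ) = w k) ∧ (∀ i, 0 < μ i) ∧
      (∀ i, μ i * m i = 1) ∧ ∀ i j, c i - v j ⬝ᵥ y i = if j = i then m i else 0 := by
  obtain ⟨w, hw⟩ := h
  obtain ⟨b, hb, himg⟩ := exists_affineBasis_dilate hv hr w
  rw [himg, isReflexive_convexHull_iff] at hw
  obtain ⟨hpos, y, hy⟩ := hw
  have hr0 : (0 : ℝ) < r := by exact_mod_cast hr
  have : Nontrivial (Fin (d + 1)) := Fin.nontrivial_iff_two_le.2 (by omega)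
  choose o ho using fun i : Fin (d + 1) => exists_ne i
  have hby : ∀ i j, j ≠ i → b j ⬝ᵥ toReal (y i) = 1 := by
    intro i j hj
    rw [hy, b.coord_apply_ne hj.symm]
    simp
  have hbv : ∀ i j, b j ⬝ᵥ toReal (y i) = r * ((v j ⬝ᵥ y i : ℤ) : ℝ) + ((w ⬝ᵥ y i : ℤ) : ℝ) := by
    intro i j
    rw [hb, add_dotProduct, smul_dotProduct, toReal_dotProduct, toReal_dotProduct, smul_eq_mul]
  have hdual : ∀ i j, v (o i) ⬝ᵥ y i - v j ⬝ᵥ y i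
      = if j = i then v (o i) ⬝ᵥ y i - v i ⬝ᵥ y i else 0 := by
    intro i j
    by_cases hj : j = i
    · subst hj; simp
    · rw [if_neg hj]
      have h1 := hby i j hj
      have h2 := hby i (o i) (ho i)
      rw [← h1, hbv, hbv] at h2
      have h3 := mul_left_cancel₀ hr0.ne' (add_right_cancel h2)
      have h4 : v (o i) ⬝ᵥ y i = v j ⬝ᵥ y i := by exact_mod_cast h3
      rw [h4, sub_self]
  have hsum : ∑ i, (r : ℝ) * b.coord i 0 = r := by
    rw [← Finset.mul_sum, b.sum_coord_apply_eq_one, mul_one]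
  have hw : ∀ k, ∑ i, (r : ℝ) * b.coord i 0 * (v i k : ℝ) = ((-w) k : ℤ) := by
    intro k
    have h := congrFun (b.linear_combination_coord_eq_self 0) k
    simp only [hb, Finset.sum_apply, Pi.smul_apply, Pi.add_apply, smul_eq_mul, mul_add,
      Finset.sum_add_distrib, ← Finset.sum_mul, b.sum_coord_apply_eq_one, toReal,
      Pi.zero_apply] at h
    rw [Pi.neg_apply, Int.cast_neg, ← eq_neg_of_add_eq_zero_left (by simpa using h)]
    exact Finset.sum_congr rfl fun i _ => by ring
  refine ⟨fun i => r * b.coord i 0, -w, fun i => v (o i) ⬝ᵥ y i - v i ⬝ᵥ y i,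
    fun i => v (o i) ⬝ᵥ y i, y, hsum, hw, fun i => mul_pos hr0 (hpos i), fun i => ?_, hdual⟩
  have h1 := mul_eq_of_dual (hdual i) fun i => r * b.coord i 0
  simp only [hw, hsum] at h1
  have h2 := hby i (o i) (ho i)
  rw [hbv] at h2
  rw [h1, ← h2]
  simp [dotProduct]
  ring

theorem isGorenstein_of_mem_lambdaSet {d : ℕ} {v : Fin (d + 1) → Fin d → ℤ}
    (hv : AffineIndependent ℝ fun i => toReal (v i)) {r : ℕ} (hr : 1 ≤ r)
    {m : Fin (d + 1) → ℕ} (hm : ∀ i, 0 < m i) (hsum : ∑ i, (1 : ℝ) / m i = r)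
    (hmem : (fun i => (((1 : ℝ) / m i : ℝ) : AddCircle (1 : ℝ))) ∈ LambdaSet v)
    (hall : ∀ lam ∈ LambdaSet v, ∀ i, m i • lam i = 0) : IsGorenstein (simplexOf v) r := by
  obtain ⟨ν, hν, hνv, -⟩ := hmem
  have hr0 : (0 : ℝ) < r := by exact_mod_cast hr
  have hm0 : ∀ i, (0 : ℝ) < m i := fun i => by exact_mod_cast hm i
  have hdiff : ∀ i, ∃ n : ℤ, (1 : ℝ) / m i = ν i + n := by
    intro i
    have h := sub_eq_zero.2 (hν i).symm
    rw [← AddCircle.coe_sub, AddCircle.coe_eq_zero_iff] at h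
    obtain ⟨n, hn⟩ := h
    refine ⟨n, ?_⟩
    have : (n : ℝ) = 1 / m i - ν i := by rw [← hn]; simp
    rw [this]; ring
  choose n hn using hdiff
  choose N hN using hνv
  set w : Fin d → ℤ := fun k => -(N k + ∑ i, n i * v i k) with hwdef
  have hw : ∀ k, ∑ i, (1 : ℝ) / m i * (v i k : ℝ) = -(w k : ℝ) := by
    intro k
    simp only [hn, add_mul, Finset.sum_add_distrib, hN, hwdef]
    push_cast
    ring
  obtain ⟨b, hb, himg⟩ := exists_affineBasis_dilate hv hr w
  refine ⟨w, ?_⟩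
  rw [himg, isReflexive_convexHull_iff]
  have hcoord0 : ∀ i, b.coord i 0 = 1 / (r * m i) := by
    refine b.coord_eq_of_sum_smul_eq (β := fun i => 1 / (r * m i)) ?_ ?_
    · have : ∀ i, 1 / ((r : ℝ) * m i) = 1 / r * (1 / m i) := fun i => by field_simp
      simp only [this]
      rw [← Finset.mul_sum, hsum]
      field_simp
    · ext k
      have : ∀ i, ((1 / ((r : ℝ) * m i)) • b i) k
          = 1 / m i * (v i k : ℝ) + 1 / m i * ((w k : ℝ) / r) := by
        intro i
        have := (hm0 i).ne'
        simp only [hb, Pi.smul_apply, Pi.add_apply, smul_eq_mul, toReal]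
        field_simp
      rw [Finset.sum_apply, Finset.sum_congr rfl fun i _ => this i, Finset.sum_add_distrib, hw,
        ← Finset.sum_mul, hsum, Pi.zero_apply]
      field_simp
      ring
  have hpos : ∀ i, 0 < b.coord i 0 := by
    intro i
    rw [hcoord0]
    have := hm0 i
    positivity
  refine ⟨hpos, ?_⟩
  have hint : ∀ (x : Fin d → ℤ) i, ∃ n : ℤ, b.coord i (toReal x) / b.coord i 0 = n := by
    intro x i
    have hxmem : (fun i => ((r * b.coord i (toReal x) : ℝ) : AddCircle (1 : ℝ))) ∈
        LambdaSet v := by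
      refine ⟨fun i => r * b.coord i (toReal x), fun i => rfl, fun k => ⟨x k - w k, ?_⟩, ⟨r, ?_⟩⟩
      · have h := congrFun (b.linear_combination_coord_eq_self (toReal x)) k
        simp only [hb, Finset.sum_apply, Pi.smul_apply, Pi.add_apply, smul_eq_mul, mul_add,
          Finset.sum_add_distrib, ← Finset.sum_mul, b.sum_coord_apply_eq_one] at h
        rw [one_mul] at h
        simp only [toReal] at h
        push_cast
        rw [← eq_sub_of_add_eq h]
        exact Finset.sum_congr rfl fun i _ => by ring!
      · rw [← Finset.mul_sum, b.sum_coord_apply_eq_one]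
        simp
    have h := hall _ hxmem i
    rw [← AddCircle.coe_nsmul, AddCircle.coe_eq_zero_iff] at h
    obtain ⟨n, hn⟩ := h
    refine ⟨n, ?_⟩
    simp only [zsmul_eq_mul, mul_one, nsmul_eq_mul] at hn
    rw [hn, hcoord0]
    field_simp
  suffices h : ∀ i, ∃ y : Fin d → ℤ, ∀ x, x ⬝ᵥ toReal y = 1 - b.coord i x / b.coord i 0 by
    choose y hy using h
    exact ⟨y, hy⟩
  intro i
  obtain ⟨z, hz⟩ := b.exists_dotProduct_eq (hpos i).ne'
  choose a ha using fun k : Fin d => hint (Pi.single k 1) i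
  refine ⟨fun k => 1 - a k, fun x => ?_⟩
  rw [← hz]
  congr 1
  ext k
  have h1 : toReal (Pi.single k 1) ⬝ᵥ z = z k := by
    have : toReal (Pi.single k 1) = Pi.single k (1 : ℝ) := by
      ext j
      by_cases h : j = k
      · subst h; simp [toReal]
      · simp [toReal, h]
    rw [this, single_one_dotProduct]
  rw [← h1, hz, ha]
  simp [toReal]

theorem volume_nonneg_sum_le (d : ℕ) {t : ℝ} (ht : 0 ≤ t) :
    volume {x : Fin d → ℝ | (∀ i, 0 ≤ x i) ∧ ∑ i, x i ≤ t}
      = ENNReal.ofReal (t ^ d / d.factorial) := by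
  induction d generalizing t with
  | zero => simp [ht, volume_pi]
  | succ n ih =>
    set S : Set (Fin (n + 1) → ℝ) := {x | (∀ i, 0 ≤ x i) ∧ ∑ i, x i ≤ t} with hS
    have hSm : MeasurableSet S := by
      rw [show S = (⋂ i, {x | 0 ≤ x i}) ∩ {x | ∑ i, x i ≤ t} by ext; simp [hS]]
      exact (MeasurableSet.iInter fun i =>
        measurableSet_le measurable_const (measurable_pi_apply i)).inter
          (measurableSet_le (by fun_prop) measurable_const)
    have hmp := (volume_preserving_piFinSuccAbove (fun _ : Fin (n + 1) => ℝ) 0).symm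
    rw [← hmp.measure_preimage hSm.nullMeasurableSet, Measure.volume_eq_prod,
      Measure.prod_apply (hmp.measurable hSm)]
    have hslice : ∀ a : ℝ, volume (Prod.mk a ⁻¹'
        ((MeasurableEquiv.piFinSuccAbove (fun _ : Fin (n + 1) => ℝ) 0).symm ⁻¹' S))
        = (Set.Icc 0 t).indicator (fun a => ENNReal.ofReal ((t - a) ^ n / n.factorial)) a := by
      intro a
      have hset : (Prod.mk a ⁻¹'
          ((MeasurableEquiv.piFinSuccAbove (fun _ : Fin (n + 1) => ℝ) 0).symm ⁻¹' S))
          = {x : Fin n → ℝ | 0 ≤ a ∧ (∀ i, 0 ≤ x i) ∧ ∑ i, x i ≤ t - a} := by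
        ext x
        simp only [hS, Set.mem_preimage, Set.mem_ofPred_eq, Fin.forall_fin_succ, Fin.sum_univ_succ]
        simp [MeasurableEquiv.piFinSuccAbove, le_sub_iff_add_le', and_assoc]
      rw [hset]
      by_cases ha : a ∈ Set.Icc 0 t
      · rw [Set.indicator_of_mem ha, ← ih (sub_nonneg.2 ha.2)]
        simp [ha.1]
      · rw [Set.indicator_of_notMem ha]
        convert measure_empty (μ := (volume : Measure (Fin n → ℝ)))
        ext x
        simp only [Set.mem_ofPred_eq, Set.mem_empty_iff_false, iff_false]
        rintro ⟨h0, hx, hs⟩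
        have := Finset.sum_nonneg fun i (_ : i ∈ Finset.univ) => hx i
        exact ha ⟨h0, by linarith⟩
    rw [lintegral_congr hslice, lintegral_indicator measurableSet_Icc,
      ← ofReal_integral_eq_lintegral_ofReal]
    · congr 1
      rw [integral_Icc_eq_integral_Ioc, ← intervalIntegral.integral_of_le ht,
        intervalIntegral.integral_div, intervalIntegral.integral_comp_sub_left (fun x => x ^ n),
        integral_pow, Nat.factorial_succ]
      push_cast
      field_simp
      simp
    · exact (by fun_prop : Continuous fun a : ℝ => (t - a) ^ n / n.factorial).integrableOn_Icc
    · filter_upwards [ae_restrict_mem measurableSet_Icc] with a ha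
      have := sub_nonneg.2 ha.2
      positivity

/-- The integer matrix whose rows are the edge vectors of the simplex at its first vertex. -/
def edgeMatrix {d : ℕ} (v : Fin (d + 1) → Fin d → ℤ) : Matrix (Fin d) (Fin d) ℤ :=
  Matrix.of fun k j => v k.succ j - v 0 j

theorem simplexOf_eq_image {d : ℕ} (v : Fin (d + 1) → Fin d → ℤ) :
    simplexOf v = (fun y => toReal (v 0) + y) ''
      (((edgeMatrix v).map (Int.cast : ℤ → ℝ)).vecMulLinear ''
        {x | (∀ i, 0 ≤ x i) ∧ ∑ i, x i ≤ 1}) := by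
  have hrow : ∀ x : Fin d → ℝ, ((edgeMatrix v).map (Int.cast : ℤ → ℝ)).vecMulLinear x
      = ∑ k, x k • (toReal (v k.succ) - toReal (v 0)) := by
    intro x
    ext j
    simp [Matrix.vecMul, dotProduct, edgeMatrix, toReal]
  apply Set.Subset.antisymm
  · apply convexHull_min
    · rintro _ ⟨i, rfl⟩
      refine Fin.cases ?_ (fun k => ?_) i
      · exact ⟨0, ⟨0, by simp, by simp⟩, by simp⟩
      · refine ⟨_, ⟨Pi.single k 1, ⟨fun i => ?_, by simp⟩, rfl⟩, ?_⟩
        · by_cases h : i = k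
          · subst h; simp
          · simp [h]
        · simp only [hrow]
          rw [Finset.sum_eq_single k]
          · simp
          · intro j _ hj; simp [hj]
          · simp
    · refine Convex.translate (Convex.linear_image ?_ _) _
      intro x hx y hy a b ha hb hab
      refine ⟨fun i => ?_, ?_⟩
      · have := hx.1 i
        have := hy.1 i
        simp only [Pi.add_apply, Pi.smul_apply, smul_eq_mul]
        positivity
      · simp only [Pi.add_apply, Pi.smul_apply, smul_eq_mul, Finset.sum_add_distrib,
          ← Finset.mul_sum]
        nlinarith [hx.2, hy.2]
  · rintro _ ⟨_, ⟨x, ⟨hx0, hx1⟩, rfl⟩, rfl⟩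
    have h := (convex_convexHull ℝ (Set.range fun i => toReal (v i))).sum_mem
      (t := Finset.univ) (w := Fin.cons (1 - ∑ i, x i) x) (z := fun i => toReal (v i))
      (fun i _ => by refine Fin.cases ?_ (fun k => ?_) i <;> simp [hx0, hx1])
      (by simp [Fin.sum_univ_succ]) (fun i _ => subset_convexHull ℝ _ ⟨i, rfl⟩)
    rw [Fin.sum_univ_succ] at h
    simp only [hrow, simplexOf]
    convert! h using 1
    simp only [Fin.cons_zero, Fin.cons_succ, smul_sub, Finset.sum_sub_distrib, sub_smul,
      ← Finset.sum_smul, one_smul]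
    abel

theorem factorial_mul_volume_simplexOf {d : ℕ} (v : Fin (d + 1) → Fin d → ℤ) :
    (d.factorial : ENNReal) * volume (simplexOf v) = ((edgeMatrix v).det.natAbs : ENNReal) := by
  rw [simplexOf_eq_image, Set.image_add_left, measure_preimage_add,
    Measure.addHaar_image_linearMap, volume_nonneg_sum_le d zero_le_one]
  have hdet : LinearMap.det ((edgeMatrix v).map (Int.cast : ℤ → ℝ)).vecMulLinear
      = ((edgeMatrix v).det : ℝ) := by
    rw [← LinearMap.det_toMatrix', ← Matrix.det_transpose]
    have h : (LinearMap.toMatrix' ((edgeMatrix v).map (Int.cast : ℤ → ℝ)).vecMulLinear).transpose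
        = (edgeMatrix v).map (Int.cast : ℤ → ℝ) := by
      ext i j
      simp [LinearMap.toMatrix'_apply]
    rw [h]
    exact ((Int.castRingHom ℝ).map_det (edgeMatrix v)).symm
  rw [hdet, one_pow, mul_left_comm, ← ENNReal.ofReal_natCast d.factorial,
    ← ENNReal.ofReal_mul (by positivity), mul_one_div_cancel (by positivity), ENNReal.ofReal_one,
    mul_one, ← Int.cast_abs, Int.abs_eq_natAbs, Int.cast_natCast, ENNReal.ofReal_natCast]

theorem card_quotient_range_vecMulLinear {d : ℕ} (A : Matrix (Fin d) (Fin d) ℤ)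
    (hA : A.det ≠ 0) :
    Nat.card ((Fin d → ℤ) ⧸ LinearMap.range A.vecMulLinear) = A.det.natAbs := by
  have hinj : Function.Injective A.vecMulLinear := by
    rw [← LinearMap.ker_eq_bot, LinearMap.ker_eq_bot']
    exact fun x hx => Matrix.eq_zero_of_vecMul_eq_zero hA hx
  rw [← Submodule.natAbs_det_equiv _ (LinearEquiv.ofInjective _ hinj)]
  have h1 : (LinearMap.range A.vecMulLinear).subtype ∘ₗ
      AddMonoidHom.toIntLinearMap (LinearEquiv.ofInjective _ hinj) = A.vecMulLinear := by
    ext; rfl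
  have h2 : LinearMap.det A.vecMulLinear = A.det := by
    rw [← LinearMap.det_toMatrix', ← Matrix.det_transpose]
    congr 1
    ext i j
    simp [LinearMap.toMatrix'_apply]
  exact congrArg Int.natAbs ((congrArg LinearMap.det h1).trans h2)

open scoped Matrix in
theorem exists_addSubgroup_lambdaSet {d : ℕ} (v : Fin (d + 1) → Fin d → ℤ)
    (hv : (edgeMatrix v).det ≠ 0) :
    ∃ H : AddSubgroup (Fin (d + 1) → AddCircle (1 : ℝ)),
      (H : Set (Fin (d + 1) → AddCircle (1 : ℝ))) = LambdaSet v ∧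
      Nat.card H = (edgeMatrix v).det.natAbs := by
  set A := (edgeMatrix v).map (Int.cast : ℤ → ℝ) with hA
  have hdet : IsUnit A.det := by
    have : A.det = ((edgeMatrix v).det : ℝ) :=
      ((Int.castRingHom ℝ).map_det (edgeMatrix v)).symm
    rw [this, isUnit_iff_ne_zero]
    exact_mod_cast hv
  have hvec : ∀ (x : Fin d → ℝ) j,
      (x ᵥ* A) j = ∑ k, x k * (v k.succ j : ℝ) - (∑ k, x k) * v 0 j := by
    intro x j
    simp [Matrix.vecMul, dotProduct, hA, edgeMatrix, mul_sub, Finset.sum_sub_distrib,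
      Finset.sum_mul]
  let ν : (Fin d → ℤ) →+ (Fin d → ℝ) := AddMonoidHom.mk' (fun n => toReal n ᵥ* A⁻¹) (by
    intro m n
    rw [← Matrix.add_vecMul]
    congr 1
    ext i
    simp [toReal])
  have hν : ∀ n, ν n ᵥ* A = toReal n := by
    intro n
    change (toReal n ᵥ* A⁻¹) ᵥ* A = _
    rw [Matrix.vecMul_vecMul, Matrix.nonsing_inv_mul _ hdet, Matrix.vecMul_one]
  have hν' : ∀ (x : Fin d → ℝ) n, x ᵥ* A = toReal n → ν n = x := by
    intro x n h
    change toReal n ᵥ* A⁻¹ = _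
    rw [← h, Matrix.vecMul_vecMul, Matrix.mul_nonsing_inv _ hdet, Matrix.vecMul_one]
  let φ : (Fin d → ℤ) →+ (Fin (d + 1) → AddCircle (1 : ℝ)) := AddMonoidHom.mk'
    (fun n i => ((Fin.cons (-∑ k, ν n k) (ν n) : Fin (d + 1) → ℝ) i : AddCircle (1 : ℝ))) (by
      intro m n
      ext i
      rw [Pi.add_apply, ← AddCircle.coe_add]
      congr 1
      refine Fin.cases ?_ (fun k => ?_) i
      · simp [Finset.sum_add_distrib, add_comm]
      · simp)
  refine ⟨φ.range, ?_, ?_⟩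
  · ext lam
    constructor
    · rintro ⟨n, rfl⟩
      refine ⟨Fin.cons (-∑ k, ν n k) (ν n), fun i => rfl, fun j => ⟨n j, ?_⟩, ⟨0, ?_⟩⟩
      · have h := congrFun (hν n) j
        rw [hvec] at h
        rw [Fin.sum_univ_succ]
        simp only [Fin.cons_zero, Fin.cons_succ]
        rw [show (n j : ℝ) = toReal n j from rfl, ← h]
        ring
      · rw [Fin.sum_univ_succ]
        simp
    · rintro ⟨μ, hμ, h1, N, hN⟩
      choose n hn using h1
      rw [Fin.sum_univ_succ] at hN
      have hx : ν (fun j => n j - N * v 0 j) = fun k => μ k.succ := by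
        apply hν'
        ext j
        have h := hn j
        rw [Fin.sum_univ_succ] at h
        rw [hvec]
        simp only [toReal]
        push_cast
        rw [← h, ← hN]
        ring
      refine ⟨fun j => n j - N * v 0 j, funext fun i => ?_⟩
      rw [← hμ i]
      change ((Fin.cons (-∑ k, ν _ k) (ν _) : Fin (d + 1) → ℝ) i : AddCircle (1 : ℝ)) = _
      rw [hx]
      refine Fin.cases ?_ (fun k => ?_) i
      · rw [Fin.cons_zero, ← sub_eq_zero, ← AddCircle.coe_sub, AddCircle.coe_eq_zero_iff]
        exact ⟨-N, by simp [← hN]; ring⟩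
      · simp
  · rw [← AddSubgroup.index_ker, ← card_quotient_range_vecMulLinear _ hv]
    have hker : φ.ker = (LinearMap.range (edgeMatrix v).vecMulLinear).toAddSubgroup := by
      ext n
      rw [AddMonoidHom.mem_ker, Submodule.mem_toAddSubgroup, LinearMap.mem_range]
      constructor
      · intro h
        have hk : ∀ k, ∃ z : ℤ, (z : ℝ) = ν n k := by
          intro k
          have h' : ((ν n k : ℝ) : AddCircle (1 : ℝ)) = 0 := congrFun h k.succ
          rw [AddCircle.coe_eq_zero_iff] at h'
          simpa using h'
        choose z hz using hk
        refine ⟨z, ?_⟩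
        have h2 := hν n
        rw [show ν n = toReal z from funext fun k => (hz k).symm] at h2
        ext j
        have h3 := congrFun h2 j
        rw [hvec] at h3
        simp only [toReal] at h3
        simp only [Matrix.vecMulLinear_apply, Matrix.vecMul, dotProduct, edgeMatrix, Matrix.of_apply,
          mul_sub, Finset.sum_sub_distrib, ← Finset.sum_mul]
        exact_mod_cast h3
      · rintro ⟨z, rfl⟩
        have hz : ν ((edgeMatrix v).vecMulLinear z) = toReal z := by
          apply hν'
          ext j
          rw [hvec]
          simp [toReal, Matrix.vecMul, dotProduct, edgeMatrix, mul_sub, Finset.sum_sub_distrib,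
            Finset.sum_mul]
        ext i
        change ((Fin.cons (-∑ k, ν _ k) (ν _) : Fin (d + 1) → ℝ) i : AddCircle (1 : ℝ)) = 0
        rw [hz, AddCircle.coe_eq_zero_iff]
        refine Fin.cases ⟨-∑ k, z k, ?_⟩ (fun k => ⟨z k, ?_⟩) i <;> simp [toReal]
    rw [hker]
    rfl

theorem exists_linearEquiv_apply_eq {d : ℕ} {f : (Fin d → ℤ) →ₗ[ℤ] ℤ} {a : Fin d → ℤ}
    (ha : f a = 1) (j : Fin d) :
    ∃ e : (Fin d → ℤ) ≃ₗ[ℤ] (Fin d → ℤ), ∀ x, e x j = f x := by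
  have hmem : ∀ x, x - f x • a ∈ LinearMap.ker f := fun x => by
    rw [LinearMap.mem_ker, map_sub, map_smul, ha, smul_eq_mul, mul_one, sub_self]
  let e₁ : (Fin d → ℤ) ≃ₗ[ℤ] ℤ × LinearMap.ker f :=
    { toFun := fun x => (f x, ⟨x - f x • a, hmem x⟩)
      map_add' := fun x y => Prod.ext (map_add f x y) (Subtype.ext (by
        change x + y - f (x + y) • a = (x - f x • a) + (y - f y • a)
        rw [map_add, add_smul, add_sub_add_comm]))
      map_smul' := fun t x => Prod.ext (map_smul f t x) (Subtype.ext (by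
        change t • x - f (t • x) • a = t • (x - f x • a)
        rw [map_smul, smul_sub, smul_assoc]))
      invFun := fun z => z.1 • a + z.2
      left_inv := fun x => add_sub_cancel (f x • a) x
      right_inv := fun z => by
        obtain ⟨t, x, hx⟩ := z
        have hfx : f (t • a + x) = t := by
          rw [map_add, map_smul, ha, LinearMap.mem_ker.1 hx, smul_eq_mul, mul_one, add_zero]
        refine Prod.ext hfx (Subtype.ext ?_)
        change t • a + x - f (t • a + x) • a = x
        rw [hfx, add_sub_cancel_left] }
  let e₃ : (Fin d → ℤ) ≃ₗ[ℤ] ℤ × ({k // k ≠ j} → ℤ) :=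
    { Equiv.funSplitAt j ℤ with
      map_add' := fun _ _ => rfl
      map_smul' := fun _ _ => rfl }
  have hrank : Module.finrank ℤ (LinearMap.ker f) = Module.finrank ℤ ({k // k ≠ j} → ℤ) := by
    have h := e₁.finrank_eq
    have h' := e₃.finrank_eq
    rw [Module.finrank_prod] at h h'
    omega
  let e₂ := LinearEquiv.ofFinrankEq (LinearMap.ker f) ({k // k ≠ j} → ℤ) hrank
  let e₄ := e₁.trans ((LinearEquiv.refl ℤ ℤ).prodCongr e₂)
  exact ⟨e₄.trans e₃.symm, fun x => congrArg Prod.fst (e₃.apply_symm_apply (e₄ x))⟩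

theorem isLatticePyramid_of_dual {d : ℕ} {v : Fin (d + 1) → Fin d → ℤ} (hd : 0 < d)
    {i : Fin (d + 1)} {c : ℤ} {y : Fin d → ℤ}
    (h : ∀ j, c - v j ⬝ᵥ y = if j = i then 1 else 0) : IsLatticePyramid (simplexOf v) := by
  have : Nontrivial (Fin (d + 1)) := Fin.nontrivial_iff_two_le.2 (by omega)
  obtain ⟨o, ho⟩ := exists_ne i
  let f : (Fin d → ℤ) →ₗ[ℤ] ℤ :=
    { toFun := fun x => -(x ⬝ᵥ y)
      map_add' := fun x z => by rw [add_dotProduct]; ring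
      map_smul' := fun t x => by
        rw [smul_dotProduct, RingHom.id_apply, smul_neg] }
  have hf : ∀ j, f (v j) = (if j = i then 1 else 0) - c := fun j => by
    rw [← h j]
    change -(v j ⬝ᵥ y) = _
    ring
  obtain ⟨e, he⟩ := exists_linearEquiv_apply_eq (f := f) (a := v i - v o)
    (by rw [map_sub, hf, hf]; simp [ho]) ⟨0, hd⟩
  set j₀ : Fin d := ⟨0, hd⟩
  let w : Fin d → ℤ := Pi.single j₀ 1 - e (v i)
  let U : Matrix (Fin d) (Fin d) ℤ := (LinearMap.toMatrix' (e : (Fin d → ℤ) →ₗ[ℤ] _)).transpose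
  have hU : ∀ x k, ∑ l, x l * U l k = e x k := by
    intro x k
    have := congrFun (LinearMap.toMatrix'_mulVec (e : (Fin d → ℤ) →ₗ[ℤ] _) x) k
    rw [LinearEquiv.coe_coe] at this
    rw [← this]
    simp only [Matrix.mulVec, dotProduct, U, Matrix.transpose_apply]
    exact Finset.sum_congr rfl fun l _ => mul_comm _ _
  let g : (Fin d → ℝ) →ᵃ[ℝ] (Fin d → ℝ) :=
    (U.map (Int.cast : ℤ → ℝ)).vecMulLinear.toAffineMap + AffineMap.const ℝ _ (toReal w)
  have hg : (fun x k => ∑ l, x l * (U l k : ℝ) + (w k : ℝ)) = g := by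
    ext x k
    simp [g, Matrix.vecMul, dotProduct, toReal]
  have hgv : ∀ x, g (toReal x) = toReal (e x + w) := by
    intro x
    rw [← hg]
    ext k
    simp only [toReal, Pi.add_apply, ← hU]
    push_cast
    rfl
  refine ⟨j₀, (Finset.univ.erase i).image fun j => e (v j) + w, ?_, U, w, ?_, ?_⟩
  · intro x hx
    obtain ⟨j, hj, rfl⟩ := Finset.mem_image.1 hx
    have hj' := Finset.ne_of_mem_erase hj
    simp [w, he, hf, hj']
  · rw [Matrix.det_transpose, LinearMap.det_toMatrix']
    exact e.isUnit_det'
  · rw [hg, simplexOf, g.image_convexHull]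
    congr 1
    have hi : toReal (e (v i) + w) = fun k => if k = j₀ then (1 : ℝ) else 0 := by
      ext k
      by_cases hk : k = j₀
      · subst hk; simp [toReal, w]
      · simp [toReal, w, hk]
    ext x
    simp only [Set.mem_union, Set.mem_image, Set.mem_singleton_iff, Set.exists_range_iff, hgv,
      ← hi, Finset.coe_image, exists_exists_and_eq_and, Finset.mem_coe, Finset.mem_erase,
      Finset.mem_univ, and_true]
    constructor
    · rintro (⟨j, -, rfl⟩ | rfl)
      · exact ⟨j, rfl⟩
      · exact ⟨i, rfl⟩
    · rintro ⟨j, rfl⟩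
      by_cases hj : j = i
      · exact Or.inr (by rw [hj])
      · exact Or.inl ⟨j, hj, rfl⟩

theorem simplexOf_comp_perm {d : ℕ} (v : Fin (d + 1) → Fin d → ℤ)
    (σ : Equiv.Perm (Fin (d + 1))) : simplexOf (fun i => v (σ i)) = simplexOf v := by
  rw [simplexOf, simplexOf, ← σ.surjective.range_comp fun i => toReal (v i)]
  rfl

theorem lambdaSet_eq_range_zsmul {d p q : ℕ} (hp : p.Prime) (hq : q.Prime) (hpq : p ≠ q)
    {v : Fin (d + 1) → Fin d → ℤ} (hv : (edgeMatrix v).det.natAbs = p * q)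
    {g : Fin (d + 1) → AddCircle (1 : ℝ)} (hg : g ∈ LambdaSet v) {m : Fin (d + 1) → ℕ}
    (hm : ∀ i (n : ℕ), n • g i = 0 → m i ∣ n)
    (hall : ∀ lam ∈ LambdaSet v, ∀ i, m i • lam i = 0) :
    LambdaSet v = Set.range fun k : ℤ => k • g := by
  have hpq0 : 0 < p * q := Nat.mul_pos hp.pos hq.pos
  obtain ⟨H, hH, hcard⟩ := exists_addSubgroup_lambdaSet v (by
    intro h
    rw [h] at hv
    exact hpq0.ne hv)
  rw [hv] at hcard
  have hfin : Finite H := Nat.finite_of_card_ne_zero (by omega)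
  have hgH : g ∈ H := by rw [← SetLike.mem_coe, hH]; exact hg
  have hkill : ∀ x : H, addOrderOf g • x = 0 := by
    intro x
    ext i
    have hx : (x : Fin (d + 1) → AddCircle (1 : ℝ)) ∈ LambdaSet v := hH ▸ x.2
    obtain ⟨t, ht⟩ := hm i (addOrderOf g) (congrFun (addOrderOf_nsmul_eq_zero g) i)
    change addOrderOf g • (x : Fin (d + 1) → AddCircle (1 : ℝ)) i = 0
    rw [ht, mul_comm, mul_nsmul', hall _ hx, nsmul_zero]
  have hdvd : ∀ l : ℕ, l.Prime → l ∣ p * q → l ∣ addOrderOf g := by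
    intro l hl hlpq
    have := Fact.mk hl
    obtain ⟨x, hx⟩ := exists_prime_addOrderOf_dvd_card' (G := H) l (hcard ▸ hlpq)
    rw [← hx]
    exact addOrderOf_dvd_of_nsmul_eq_zero (hkill x)
  have hle : AddSubgroup.zmultiples g ≤ H := by simpa using hgH
  have hpos : 0 < addOrderOf g := by
    have := AddSubgroup.addOrderOf_mk g hgH
    rw [← this]
    exact addOrderOf_pos _
  have hdvd' : p * q ∣ addOrderOf g :=
    Nat.Coprime.mul_dvd_of_dvd_of_dvd ((Nat.coprime_primes hp hq).2 hpq)
      (hdvd p hp (dvd_mul_right p q)) (hdvd q hq (dvd_mul_left q p))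
  have heq := AddSubgroup.eq_of_le_of_card_ge hle (by
    rw [hcard, Nat.card_zmultiples]
    exact Nat.le_of_dvd hpos hdvd')
  rw [← hH, ← heq]
  rfl

theorem exists_perm_sorted_fin_three {n : ℕ} (f : Fin n → Fin 3) :
    ∃ s₁ s₂ s₃ : ℕ, s₁ + s₂ + s₃ = n ∧ ∃ σ : Equiv.Perm (Fin n), ∀ i : Fin n,
      f (σ i) = if (i : ℕ) < s₁ then 0 else if (i : ℕ) < s₁ + s₂ then 1 else 2 := by
  have hmono : Monotone (f ∘ Tuple.sort f) := Tuple.monotone_sort f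
  set h := f ∘ Tuple.sort f with hh
  have hcard : ∀ c : ℕ, ∃ s ≤ n, ∀ i : Fin n, (i : ℕ) < s ↔ (h i : ℕ) < c := by
    intro c
    by_cases hex : ∃ i : Fin n, c ≤ (h i : ℕ)
    · classical
      have hex' : ∃ k, ∃ hk : k < n, c ≤ (h ⟨k, hk⟩ : ℕ) := by
        obtain ⟨i, hi⟩ := hex
        exact ⟨i, i.2, hi⟩
      obtain ⟨hk, hspec⟩ := Nat.find_spec hex'
      refine ⟨Nat.find hex', hk.le, fun i => ⟨fun hi => ?_, fun hi => ?_⟩⟩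
      · have := Nat.find_min hex' hi
        push Not at this
        exact this i.2
      · by_contra hcon
        have := hmono (show (⟨Nat.find hex', hk⟩ : Fin n) ≤ i from not_lt.1 hcon)
        have : (h ⟨Nat.find hex', hk⟩ : ℕ) ≤ h i := this
        omega
    · push Not at hex
      exact ⟨n, le_rfl, fun i => ⟨fun _ => hex i, fun _ => i.2⟩⟩
  obtain ⟨a, ha, ha'⟩ := hcard 1
  obtain ⟨b, hb, hb'⟩ := hcard 2
  have hab : a ≤ b := by
    by_contra hcon
    have h1 := (ha' ⟨b, by omega⟩).1 (by simpa using hcon)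
    have h2 := (hb' ⟨b, by omega⟩).2 (by omega)
    simp at h2
  refine ⟨a, b - a, n - b, by omega, Tuple.sort f, fun i => ?_⟩
  change h i = _
  have h1 := ha' i
  have h2 := hb' i
  rw [Nat.add_sub_cancel' hab]
  split_ifs with h3 h4
  · ext
    simp only [Fin.val_zero]
    have := h1.1 h3
    omega
  · ext
    simp only [Fin.val_one]
    have := h2.1 h4
    have : ¬ (h i : ℕ) < 1 := fun hc => h3 (h1.2 hc)
    omega
  · ext
    simp only [Fin.val_two]
    have : ¬ (h i : ℕ) < 2 := fun hc => h4 (h2.2 hc)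
    omega

theorem sum_one_div_eq {n s₁ s₂ s₃ : ℕ} (h : s₁ + s₂ + s₃ = n) {p q : ℕ} :
    ∑ i : Fin n, (1 : ℝ) /
        ((if (i : ℕ) < s₁ then p else if (i : ℕ) < s₁ + s₂ then q else p * q : ℕ) : ℝ)
      = s₁ / p + s₂ / q + s₃ / (p * q) := by
  rw [Fin.sum_univ_eq_sum_range fun i : ℕ => (1 : ℝ) /
    ((if i < s₁ then p else if i < s₁ + s₂ then q else p * q : ℕ) : ℝ), ← h,
    Finset.sum_range_add, Finset.sum_range_add]
  congr 1
  · congr 1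
    · rw [Finset.sum_congr rfl fun i hi => by rw [if_pos (Finset.mem_range.1 hi)]]
      simp [div_eq_mul_inv]
    · rw [Finset.sum_congr rfl fun i hi => by
        rw [if_neg (by omega), if_pos (by have := Finset.mem_range.1 hi; omega)]]
      simp [div_eq_mul_inv]
  · rw [Finset.sum_congr rfl fun i hi => by rw [if_neg (by omega), if_neg (by omega)]]
    simp [div_eq_mul_inv]

theorem genPQ_eq (d s₁ s₂ p q : ℕ) : genPQ d s₁ s₂ p q = fun i : Fin (d + 1) =>
    (((1 : ℝ) / ((if (i : ℕ) < s₁ then p else if (i : ℕ) < s₁ + s₂ then q else p * q : ℕ) : ℝ) :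
      ℝ) : AddCircle (1 : ℝ)) := by
  ext i
  rw [genPQ]
  split_ifs <;> simp

theorem sum_div_eq_iff {p q r s₁ s₂ s₃ : ℕ} (hp : 0 < p) (hq : 0 < q) :
    (s₁ / p + s₂ / q + s₃ / (p * q) : ℝ) = r ↔ r * p * q = s₁ * q + s₂ * p + s₃ := by
  have hp' : (p : ℝ) ≠ 0 := by positivity
  have hq' : (q : ℝ) ≠ 0 := by positivity
  rw [← @Nat.cast_inj ℝ]
  push_cast
  have : (s₁ / p + s₂ / q + s₃ / (p * q) : ℝ) = (s₁ * q + s₂ * p + s₃) / (p * q) := by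
    field_simp
  rw [this, div_eq_iff (mul_ne_zero hp' hq'), eq_comm, mul_assoc]

theorem natCast_nsmul_one_div_eq_zero_iff {m : ℕ} (hm : 0 < m) (n : ℕ) :
    n • (((1 : ℝ) / m : ℝ) : AddCircle (1 : ℝ)) = 0 ↔ m ∣ n := by
  have hm' : (m : ℝ) ≠ 0 := by positivity
  rw [← AddCircle.coe_nsmul, AddCircle.coe_eq_zero_iff, ← Int.natCast_dvd_natCast]
  refine exists_congr fun k => ?_
  rw [zsmul_eq_mul, mul_one, nsmul_eq_mul, mul_one_div, eq_div_iff hm', mul_comm, eq_comm]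
  norm_cast

/-- a `d`-dimensional lattice simplex of normalized volume `pq`
(`p ≠ q` primes), not a lattice pyramid, is Gorenstein of index `r` iff there are
`s₁ + s₂ + s₃ = d + 1` with `rpq = s₁ q + s₂ p + s₃` such that, after reordering the
vertices, `Λ_Δ` is generated by the element with `s₁` entries `1/p`, `s₂` entries
`1/q` and `s₃` entries `1/(pq)`. -/
theorem statement14 {d : ℕ} (p q : ℕ) (hp : p.Prime) (hq : q.Prime) (hpq : p ≠ q)
    (v : Fin (d + 1) → Fin d → ℤ)
    (hΔ : AffineIndependent ℝ fun i => toReal (v i))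
    (hvol : (Nat.factorial d : ENNReal) * volume (simplexOf v) = ((p * q : ℕ) : ENNReal))
    (hpyr : ¬ IsLatticePyramid (simplexOf v)) (r : ℕ) (hr : 1 ≤ r) :
    IsGorenstein (simplexOf v) r ↔
      ∃ s₁ s₂ s₃ : ℕ, s₁ + s₂ + s₃ = d + 1 ∧ r * p * q = s₁ * q + s₂ * p + s₃ ∧
        ∃ σ : Equiv.Perm (Fin (d + 1)),
          LambdaSet (fun i => v (σ i)) = Set.range fun k : ℤ => k • genPQ d s₁ s₂ p q := by
  have hp0 := hp.pos
  have hq0 := hq.pos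
  have hdet : ∀ u : Fin (d + 1) → Fin d → ℤ, simplexOf u = simplexOf v →
      (edgeMatrix u).det.natAbs = p * q := by
    intro u hu
    have h := factorial_mul_volume_simplexOf u
    rw [hu, hvol] at h
    exact_mod_cast h.symm
  have hd : 0 < d := by
    rw [Nat.pos_iff_ne_zero]
    rintro rfl
    have h := hdet v rfl
    rw [Matrix.det_isEmpty, Int.natAbs_one] at h
    exact hp.one_lt.ne' (Nat.eq_one_of_mul_eq_one_right h.symm)
  constructor
  · intro hG
    obtain ⟨μ, w, m', c, y, hsum, hw, hpos, hm', hdual⟩ := hG.exists_dual hd hΔ hr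
    have hmpos : ∀ i, 0 < m' i := by
      intro i
      have : (0 : ℝ) < m' i := pos_of_mul_pos_right (by rw [hm' i]; exact one_pos) (hpos i).le
      exact_mod_cast this
    lift m' to Fin (d + 1) → ℕ using fun i => (hmpos i).le with m
    simp only [Nat.cast_pos, Int.cast_natCast] at hmpos hm' hdual
    have hμ : ∀ i, μ i = 1 / m i := fun i => eq_one_div_of_mul_eq_one_left (hm' i)
    have hμmem : (fun i => (μ i : AddCircle (1 : ℝ))) ∈ LambdaSet v :=
      ⟨μ, fun i => rfl, fun k => ⟨w k, hw k⟩, ⟨r, by simpa using hsum⟩⟩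
    have hdvd : ∀ i, m i ∣ p * q := by
      intro i
      have hv := hdet v rfl
      obtain ⟨H, hH, hcard⟩ := exists_addSubgroup_lambdaSet v (by
        intro h
        rw [h] at hv
        exact (Nat.mul_pos hp0 hq0).ne hv)
      rw [← hH] at hμmem
      have h := card_nsmul_eq_zero' (G := H) (x := ⟨_, hμmem⟩)
      rw [hcard, hv] at h
      have h' := congrFun (congrArg Subtype.val h) i
      rw [← natCast_nsmul_one_div_eq_zero_iff (hmpos i), ← hμ]
      exact h'
    have hne : ∀ i, m i ≠ 1 := by
      intro i hi
      refine hpyr (isLatticePyramid_of_dual hd (i := i) (c := c i) (y := y i) fun j => ?_)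
      rw [hdual, hi, Nat.cast_one]
    have hcases : ∀ i, m i = p ∨ m i = q ∨ m i = p * q := by
      intro i
      obtain ⟨a, b, ha, hb, hab⟩ := Nat.dvd_mul.1 (hdvd i)
      rcases (Nat.dvd_prime hp).1 ha with ha | ha <;>
        rcases (Nat.dvd_prime hq).1 hb with hb | hb <;> rw [ha, hb] at hab
      · exact absurd hab.symm (hne i)
      · exact Or.inr (Or.inl (by rw [← hab, one_mul]))
      · exact Or.inl (by rw [← hab, mul_one])
      · exact Or.inr (Or.inr hab.symm)
    obtain ⟨s₁, s₂, s₃, hs, σ, hσ⟩ := exists_perm_sorted_fin_three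
      fun i => if m i = p then (0 : Fin 3) else if m i = q then 1 else 2
    have hmσ : ∀ i, m (σ i)
        = if (i : ℕ) < s₁ then p else if (i : ℕ) < s₁ + s₂ then q else p * q := by
      intro i
      have h := hσ i
      have h' := hcases (σ i)
      split_ifs at h ⊢ <;> simp_all
    have hgen : genPQ d s₁ s₂ p q = fun i => ((μ (σ i) : ℝ) : AddCircle (1 : ℝ)) := by
      rw [genPQ_eq]
      ext i
      rw [hμ, hmσ]
    refine ⟨s₁, s₂, s₃, hs, ?_, σ, ?_⟩
    · rw [← sum_div_eq_iff hp0 hq0, ← sum_one_div_eq hs, ← hsum, ← Equiv.sum_comp σ μ]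
      exact Finset.sum_congr rfl fun i _ => by rw [hμ, hmσ]
    · rw [hgen]
      refine lambdaSet_eq_range_zsmul hp hq hpq (hdet _ (simplexOf_comp_perm v σ)) ?_
        (m := fun i => m (σ i)) (fun i n hn => ?_) (fun lam hlam i => ?_)
      · refine ⟨fun i => μ (σ i), fun i => rfl, fun k => ⟨w k, ?_⟩, ⟨r, ?_⟩⟩
        · exact (Equiv.sum_comp σ fun i => μ i * (v i k : ℝ)).trans (hw k)
        · rw [Equiv.sum_comp σ μ, hsum, Int.cast_natCast]
      · rw [hμ] at hn
        exact (natCast_nsmul_one_div_eq_zero_iff (hmpos _) n).1 hn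
      · have h := zsmul_eq_zero_of_dual (v := fun i => v (σ i)) (i := i) (c := c (σ i))
          (m := m (σ i)) (y := y (σ i)) (fun j => by simp [hdual]) hlam
        rwa [natCast_zsmul] at h
  · rintro ⟨s₁, s₂, s₃, hs, hrpq, σ, hσ⟩
    rw [← simplexOf_comp_perm v σ]
    have hm : ∀ i : Fin (d + 1),
        0 < if (i : ℕ) < s₁ then p else if (i : ℕ) < s₁ + s₂ then q else p * q := by
      intro i
      split_ifs <;> positivity
    have hΔσ : AffineIndependent ℝ fun i => toReal (v (σ i)) := hΔ.comp_embedding σ.toEmbedding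
    refine isGorenstein_of_mem_lambdaSet (v := fun i => v (σ i)) hΔσ hr hm ?_ ?_ ?_
    · rw [sum_one_div_eq hs, sum_div_eq_iff hp0 hq0, hrpq]
    · rw [hσ, genPQ_eq]
      exact ⟨1, one_zsmul _⟩
    · intro lam hlam i
      rw [hσ, genPQ_eq] at hlam
      obtain ⟨k, rfl⟩ := hlam
      beta_reduce
      rw [Pi.smul_apply, smul_comm, (natCast_nsmul_one_div_eq_zero_iff (hm i) _).2 dvd_rfl,
        smul_zero]
end
end
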